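/- arXiv:2201.11566 — 10 statements merged into one kernel-verified Lean document; each statement's English description precedes it below -/
import Mathlib

section
/- Let (M,L) be a linear space. For any pairwise disjoint finite subsets A, B, C of M, the predimension δ satisfies δ(A ∪ B ∪ C) − δ(A ∪ B) ≤ δ(A ∪ C) − δ(A); that is, the relative predimension δ(C/A) := δ(A ∪ C) − δ(A) satisfies δ(C/A) ≥ δ(C/A ∪ B). -/
open scoped Classical

/-- A linear space: a set of points with a family of lines, each line having at
least 3 points, such that two distinct points lie on at most one line. -/
structure LinearSpace (M : Type*) where
  lines : Set (Set M)
  three_le : ∀ ℓ ∈ lines, ∃ x y z : M,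
    x ∈ ℓ ∧ y ∈ ℓ ∧ z ∈ ℓ ∧ x ≠ y ∧ x ≠ z ∧ y ≠ z
  unique_line : ∀ ⦃x y : M⦄, x ≠ y → ∀ ⦃ℓ₁ : Set M⦄, ℓ₁ ∈ lines →
    ∀ ⦃ℓ₂ : Set M⦄, ℓ₂ ∈ lines →
    x ∈ ℓ₁ → y ∈ ℓ₁ → x ∈ ℓ₂ → y ∈ ℓ₂ → ℓ₁ = ℓ₂

variable {M : Type*}

/-- The lines meeting a finite set `S` in at least two points. -/
def lineContrib (LS : LinearSpace M) (S : Finset M) : Set (Set M) :=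
  {ℓ | ℓ ∈ LS.lines ∧ 2 ≤ (S.filter (· ∈ ℓ)).card}

lemma lineContrib_finite (LS : LinearSpace M) (S : Finset M) :
    (lineContrib LS S).Finite := by
  have hinj : Set.InjOn (fun ℓ => S.filter (· ∈ ℓ)) (lineContrib LS S) := by
    rintro ℓ₁ ⟨h1, h1c⟩ ℓ₂ ⟨h2, h2c⟩ heq
    simp only at heq
    obtain ⟨x, hx, y, hy, hxy⟩ :=
      Finset.one_lt_card.mp (lt_of_lt_of_le one_lt_two h1c)
    have hx1 := Finset.mem_filter.mp hx
    have hy1 := Finset.mem_filter.mp hy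
    have hx2 := Finset.mem_filter.mp (heq ▸ hx)
    have hy2 := Finset.mem_filter.mp (heq ▸ hy)
    exact LS.unique_line hxy h1 h2 hx1.2 hy1.2 hx2.2 hy2.2
  have himg : (fun ℓ => S.filter (· ∈ ℓ)) '' lineContrib LS S ⊆ ↑S.powerset := by
    rintro t ⟨ℓ, -, rfl⟩
    exact Finset.mem_coe.mpr (Finset.mem_powerset.mpr (Finset.filter_subset _ S))
  exact Set.Finite.of_finite_image
    (Set.Finite.subset S.powerset.finite_toSet himg) hinj

/-- The predimension `δ(S) = |S| - Σ_ℓ max(|ℓ ∩ S| - 2, 0)` of a finite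
subset of a linear space. -/
noncomputable def delta (LS : LinearSpace M) (S : Finset M) : ℤ :=
  (S.card : ℤ) -
    ∑ ℓ ∈ (lineContrib_finite LS S).toFinset, ((S.filter (· ∈ ℓ)).card - 2 : ℤ)

lemma lineContrib_mono (LS : LinearSpace M) {S T : Finset M} (hST : S ⊆ T) :
    lineContrib LS S ⊆ lineContrib LS T :=
  fun _ hl => ⟨hl.1, hl.2.trans (Finset.card_le_card (Finset.filter_subset_filter _ hST))⟩

/-- The predimension of `S` can be computed by summing truncated contributions over
the lines that meet a larger finite set in at least two points. -/
lemma delta_eq_of_subset (LS : LinearSpace M) {S T : Finset M} (hST : S ⊆ T) :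
    delta LS S = (S.card : ℤ) -
      ∑ ℓ ∈ (lineContrib_finite LS T).toFinset, (((S.filter (· ∈ ℓ)).card - 2 : ℕ) : ℤ) := by
  have hsub : (lineContrib_finite LS S).toFinset ⊆ (lineContrib_finite LS T).toFinset :=
    Set.Finite.toFinset_subset_toFinset.mpr (lineContrib_mono LS hST)
  rw [delta, ← Finset.sum_subset hsub]
  · congr 1
    refine Finset.sum_congr rfl fun ℓ hl => ?_
    have h2 := ((Set.Finite.mem_toFinset _).mp hl).2
    push_cast [Nat.cast_sub h2]
    rfl
  · intro ℓ hT hS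
    have hlines := ((Set.Finite.mem_toFinset _).mp hT).1
    have hlt : ¬ 2 ≤ (S.filter (· ∈ ℓ)).card := fun h =>
      hS ((Set.Finite.mem_toFinset _).mpr ⟨hlines, h⟩)
    rw [Nat.sub_eq_zero_of_le (not_le.mp hlt).le, Nat.cast_zero]

/-- In a linear space, for pairwise disjoint finite subsets
`A`, `B`, `C`, the predimension satisfies
`δ(A ∪ B ∪ C) − δ(A ∪ B) ≤ δ(A ∪ C) − δ(A)`, i.e. the relative predimension
`δ(C/A) = δ(A ∪ C) − δ(A)` satisfies `δ(C/A) ≥ δ(C/A ∪ B)`. -/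
theorem delta_submodular (M : Type*) (LS : LinearSpace M) (A B C : Finset M)
    (hAB : Disjoint A B) (hAC : Disjoint A C) (hBC : Disjoint B C) :
    delta LS (A ∪ B ∪ C) - delta LS (A ∪ B) ≤ delta LS (A ∪ C) - delta LS A := by
  have hABC : Disjoint (A ∪ B) C := Finset.disjoint_union_left.mpr ⟨hAC, hBC⟩
  have hAsub : A ⊆ A ∪ B ∪ C := Finset.subset_union_left.trans Finset.subset_union_left
  have hACsub : A ∪ C ⊆ A ∪ B ∪ C :=
    Finset.union_subset_union_left Finset.subset_union_left
  rw [delta_eq_of_subset LS (Finset.Subset.refl (A ∪ B ∪ C)),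
    delta_eq_of_subset LS (Finset.subset_union_left : A ∪ B ⊆ A ∪ B ∪ C),
    delta_eq_of_subset LS hACsub, delta_eq_of_subset LS hAsub]
  have hsum := Finset.sum_le_sum (s := (lineContrib_finite LS (A ∪ B ∪ C)).toFinset)
    (f := fun ℓ => (((A ∪ B).filter (· ∈ ℓ)).card - 2 : ℕ) +
      ((((A ∪ C).filter (· ∈ ℓ)).card - 2 : ℕ) : ℤ))
    (g := fun ℓ => (((A ∪ B ∪ C).filter (· ∈ ℓ)).card - 2 : ℕ) +
      (((A.filter (· ∈ ℓ)).card - 2 : ℕ) : ℤ)) (fun ℓ _ => by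
        simp only [Finset.filter_union]
        rw [← Finset.filter_union,
          Finset.card_union_of_disjoint (Finset.disjoint_filter_filter hABC),
          Finset.filter_union,
          Finset.card_union_of_disjoint (Finset.disjoint_filter_filter hAB),
          Finset.card_union_of_disjoint (Finset.disjoint_filter_filter hAC)]
        omega)
  simp only [Finset.sum_add_distrib] at hsum
  rw [Finset.card_union_of_disjoint hABC, Finset.card_union_of_disjoint hAB,
    Finset.card_union_of_disjoint hAC]
  push_cast
  linarith
end

section
/- Let K^sp be the class of finite linear spaces A such that every subset S ⊆ A with |S| ≥ 2 satisfies δ(S) ≥ 2 and every subset S with |S| ≥ 4 satisfies δ(S) ≥ 3. Then (K^sp, ≤) has the strong amalgamation property: if A, B ∈ K^sp have common induced subspace C = A ∩ B with C ≤ A and C ≤ B, then there exist D ∈ K^sp and embeddings f : A → D and g : B → D agreeing on C such that f(A) ≤ D and g(B) ≤ D. -/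
open scoped Classical

variable {M : Type*}

/-- Three points are collinear if some line contains all of them. -/
def Collin (LS : LinearSpace M) (x y z : M) : Prop :=
  ∃ ℓ ∈ LS.lines, x ∈ ℓ ∧ y ∈ ℓ ∧ z ∈ ℓ

/-- An embedding of linear spaces: an injection under which three distinct
points are collinear if and only if their images are collinear. -/
def IsLSEmbedding {A B : Type*} (LA : LinearSpace A) (LB : LinearSpace B)
    (f : A → B) : Prop :=
  Function.Injective f ∧
  ∀ x y z : A, x ≠ y → x ≠ z → y ≠ z →
    (Collin LA x y z ↔ Collin LB (f x) (f y) (f z))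

/-- A finite subset `s` is strong in the whole space: `δ(X) ≥ δ(s)` for every
finite `X ⊇ s`. -/
def StrongFin (LS : LinearSpace M) (s : Set M) : Prop :=
  ∃ hs : s.Finite, ∀ X : Finset M, hs.toFinset ⊆ X →
    delta LS hs.toFinset ≤ delta LS X

/-- The strong amalgamation property for a class of finite linear spaces
given by the property `P`: whenever `A, B` in the class have a common induced
strong subspace `C`, there are strong embeddings of `A` and `B`, agreeing on
`C`, into some `D` in the class. -/
def AmalgProp (P : {M : Type u} → LinearSpace M → Prop) : Prop :=
  ∀ (A B C : Type u) (LA : LinearSpace A) (LB : LinearSpace B)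
    (LC : LinearSpace C), Finite A → Finite B → Finite C →
    P LA → P LB → P LC →
    ∀ (eA : C → A) (eB : C → B),
      IsLSEmbedding LC LA eA → IsLSEmbedding LC LB eB →
      StrongFin LA (Set.range eA) → StrongFin LB (Set.range eB) →
      ∃ (D : Type u) (LD : LinearSpace D) (f : A → D) (g : B → D),
        Finite D ∧ P LD ∧ IsLSEmbedding LA LD f ∧ IsLSEmbedding LB LD g ∧
        (∀ c : C, f (eA c) = g (eB c)) ∧
        StrongFin LD (Set.range f) ∧ StrongFin LD (Set.range g)

/-- Membership in the class `K^sp`: every subset `S` with `|S| ≥ 2` has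
`δ(S) ≥ 2` and every subset `S` with `|S| ≥ 4` has `δ(S) ≥ 3`. -/
def SparseLS {M : Type*} (LS : LinearSpace M) : Prop :=
  ∀ S : Finset M, (2 ≤ S.card → 2 ≤ delta LS S) ∧ (4 ≤ S.card → 3 ≤ delta LS S)

universe u

/-- The lines contained in a finite set of points, as finite sets. -/
noncomputable def linesIn (LS : LinearSpace M) (S : Finset M) : Finset (Finset M) :=
  S.powerset.filter fun t => (t : Set M) ∈ LS.lines

lemma mem_linesIn {LS : LinearSpace M} {S t : Finset M} :
    t ∈ linesIn LS S ↔ t ⊆ S ∧ (t : Set M) ∈ LS.lines := by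
  simp [linesIn]

/-- Every line has exactly three points. -/
def LinearSpace.IsTriple (LS : LinearSpace M) : Prop :=
  ∀ ℓ ∈ LS.lines, ℓ.ncard = 3

namespace LinearSpace.IsTriple

variable {LS : LinearSpace M}

lemma finite (h : LS.IsTriple) {ℓ : Set M} (hl : ℓ ∈ LS.lines) : ℓ.Finite :=
  Set.finite_of_ncard_ne_zero (by rw [h ℓ hl]; decide)

lemma card_eq (h : LS.IsTriple) {t : Finset M} (ht : (t : Set M) ∈ LS.lines) :
    t.card = 3 := by
  rw [← Set.ncard_coe_finset, h _ ht]

lemma delta_eq (h : LS.IsTriple) (S : Finset M) :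
    delta LS S = S.card - (linesIn LS S).card := by
  unfold delta
  congr 1
  have hsub : (linesIn LS S).image (fun t : Finset M => (t : Set M)) ⊆
      (lineContrib_finite LS S).toFinset := by
    intro ℓ hl
    obtain ⟨t, ht, rfl⟩ := Finset.mem_image.mp hl
    obtain ⟨hts, htl⟩ := mem_linesIn.mp ht
    rw [Set.Finite.mem_toFinset]
    exact ⟨htl, calc
      2 ≤ t.card := by rw [h.card_eq htl]; decide
      _ ≤ _ := Finset.card_le_card fun x hx => by simp [hts hx, hx]⟩
  rw [← Finset.sum_subset hsub, Finset.sum_image (by simp), Finset.card_eq_sum_ones]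
  · push_cast
    refine Finset.sum_congr rfl fun t ht => ?_
    obtain ⟨hts, htl⟩ := mem_linesIn.mp ht
    have he : ∀ inst, @Finset.filter M (· ∈ (t : Set M)) inst S = t := fun _ => by
      ext x
      simpa using fun hx => hts hx
    rw [he, h.card_eq htl]
    norm_num
  · intro ℓ hl hnot
    rw [Set.Finite.mem_toFinset] at hl
    obtain ⟨hl, h2⟩ := hl
    have hfin := h.finite hl
    have hc : hfin.toFinset.card = 3 := by
      rw [← Set.ncard_eq_toFinset_card ℓ hfin, h ℓ hl]
    have hle : S.filter (· ∈ ℓ) ⊆ hfin.toFinset := fun x hx => by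
      simpa using (Finset.mem_filter.mp hx).2
    have hne : S.filter (· ∈ ℓ) ≠ hfin.toFinset := by
      intro he
      refine hnot (Finset.mem_image.mpr ⟨hfin.toFinset, mem_linesIn.mpr ⟨?_, ?_⟩, ?_⟩)
      · rw [← he]; exact Finset.filter_subset _ _
      · simpa using hl
      · simp
    have := Finset.card_lt_card (hle.ssubset_of_ne hne)
    have h22 : (S.filter (· ∈ ℓ)).card = 2 := by omega
    rw [h22]
    norm_num

lemma eq_of_subset (h : LS.IsTriple) {t : Finset M} {ℓ : Set M} (hl : ℓ ∈ LS.lines)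
    (ht : (t : Set M) ⊆ ℓ) (hc : t.card = 3) : (t : Set M) = ℓ :=
  Set.eq_of_subset_of_ncard_le ht (by rw [h ℓ hl, Set.ncard_coe_finset, hc]) (h.finite hl)

lemma collin_iff (h : LS.IsTriple) {x y z : M} (hxy : x ≠ y) (hxz : x ≠ z) (hyz : y ≠ z) :
    Collin LS x y z ↔ ((({x, y, z} : Finset M)) : Set M) ∈ LS.lines := by
  constructor
  · rintro ⟨ℓ, hl, hx, hy, hz⟩
    rw [h.eq_of_subset hl (t := {x, y, z})]
    · exact hl
    · intro w hw
      simp at hw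
      rcases hw with rfl | rfl | rfl <;> assumption
    · exact Finset.card_eq_three.mpr ⟨x, y, z, hxy, hxz, hyz, rfl⟩
  · intro hl
    exact ⟨_, hl, by simp, by simp, by simp⟩

lemma delta_union_add_inter_le (h : LS.IsTriple) (P Q : Finset M) :
    delta LS (P ∪ Q) + delta LS (P ∩ Q) ≤ delta LS P + delta LS Q := by
  simp only [h.delta_eq]
  have h1 := Finset.card_union_add_card_inter P Q
  have h2 := Finset.card_union_add_card_inter (linesIn LS P) (linesIn LS Q)
  have h3 : linesIn LS P ∪ linesIn LS Q ⊆ linesIn LS (P ∪ Q) := by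
    intro t
    simp only [Finset.mem_union, mem_linesIn]
    rintro (⟨h, hl⟩ | ⟨h, hl⟩)
    · exact ⟨h.trans Finset.subset_union_left, hl⟩
    · exact ⟨h.trans Finset.subset_union_right, hl⟩
  have h4 : linesIn LS P ∩ linesIn LS Q = linesIn LS (P ∩ Q) := by
    ext t
    simp only [Finset.mem_inter, mem_linesIn, Finset.subset_inter_iff]
    tauto
  have h5 := Finset.card_le_card h3
  rw [h4] at h2
  omega

lemma delta_union_add_inter (h : LS.IsTriple) (P Q : Finset M)
    (hPQ : ∀ t : Finset M, (t : Set M) ∈ LS.lines → t ⊆ P ∪ Q → t ⊆ P ∨ t ⊆ Q) :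
    delta LS (P ∪ Q) + delta LS (P ∩ Q) = delta LS P + delta LS Q := by
  refine le_antisymm (h.delta_union_add_inter_le P Q) ?_
  simp only [h.delta_eq]
  have h1 := Finset.card_union_add_card_inter P Q
  have h2 := Finset.card_union_add_card_inter (linesIn LS P) (linesIn LS Q)
  have h3 : linesIn LS (P ∪ Q) ⊆ linesIn LS P ∪ linesIn LS Q := by
    intro t ht
    obtain ⟨hs, hl⟩ := mem_linesIn.mp ht
    simp only [Finset.mem_union, mem_linesIn]
    rcases hPQ t hl hs with h | h
    · exact Or.inl ⟨h, hl⟩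
    · exact Or.inr ⟨h, hl⟩
  have h4 : linesIn LS P ∩ linesIn LS Q = linesIn LS (P ∩ Q) := by
    ext t
    simp only [Finset.mem_inter, mem_linesIn, Finset.subset_inter_iff]
    tauto
  have h5 := Finset.card_le_card h3
  rw [h4] at h2
  omega

lemma delta_of_card_le_two (h : LS.IsTriple) {S : Finset M} (hS : S.card ≤ 2) :
    delta LS S = S.card := by
  have : linesIn LS S = ∅ := by
    refine Finset.eq_empty_of_forall_notMem fun t ht => ?_
    obtain ⟨hs, hl⟩ := mem_linesIn.mp ht
    have := Finset.card_le_card hs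
    rw [h.card_eq hl] at this
    omega
  rw [h.delta_eq, this]
  simp

lemma delta_of_card_eq_three (h : LS.IsTriple) {S : Finset M} (hS : S.card = 3)
    (hl : (S : Set M) ∉ LS.lines) : delta LS S = 3 := by
  have : linesIn LS S = ∅ := by
    refine Finset.eq_empty_of_forall_notMem fun t ht => ?_
    obtain ⟨hs, htl⟩ := mem_linesIn.mp ht
    rw [Finset.eq_of_subset_of_card_le hs (by rw [h.card_eq htl, hS])] at htl
    exact hl htl
  rw [h.delta_eq, this, hS]
  simp

end LinearSpace.IsTriple

lemma SparseLS.isTriple [Finite M] {LS : LinearSpace M} (h : SparseLS LS) : LS.IsTriple := by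
  intro ℓ hl
  have hfin : ℓ.Finite := Set.toFinite ℓ
  have hc := Set.ncard_eq_toFinset_card ℓ hfin
  have he : hfin.toFinset.filter (· ∈ ℓ) = hfin.toFinset := by
    ext x
    simp
  obtain ⟨x, y, z, hx, hy, hz, hxy, hxz, hyz⟩ := LS.three_le ℓ hl
  have h3 : 3 ≤ hfin.toFinset.card := by
    rw [← Finset.card_eq_three.mpr ⟨x, y, z, hxy, hxz, hyz, rfl⟩]
    refine Finset.card_le_card fun w hw => ?_
    simp only [Finset.mem_insert, Finset.mem_singleton] at hw
    rcases hw with rfl | rfl | rfl <;> simpa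
  have hmem : ℓ ∈ (lineContrib_finite LS hfin.toFinset).toFinset := by
    rw [Set.Finite.mem_toFinset]
    exact ⟨hl, by rw [he]; omega⟩
  have hsum := Finset.single_le_sum
    (f := fun ℓ => (((hfin.toFinset.filter (· ∈ ℓ)).card : ℤ) - 2))
    (fun ℓ' h' => by
      rw [Set.Finite.mem_toFinset] at h'
      have := h'.2
      omega) hmem
  have hd : delta LS hfin.toFinset ≤ 2 := by
    unfold delta
    simp only [he] at hsum
    linarith
  have h4 := (h hfin.toFinset).2
  rw [hc]
  by_contra hne
  have := h4 (by omega)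
  omega

/-- Two maps from a common index set pull lines back to the same sets. -/
def SameLines {A B C : Type*} (LA : LinearSpace A) (LB : LinearSpace B)
    (eA : C → A) (eB : C → B) : Prop :=
  ∀ t : Finset C, ((t.image eA : Finset A) : Set A) ∈ LA.lines ↔
    ((t.image eB : Finset B) : Set B) ∈ LB.lines

lemma card_linesIn_image {A C : Type*} (LA : LinearSpace A) {eA : C → A}
    (hA : Function.Injective eA) (s : Finset C) :
    (linesIn LA (s.image eA)).card =
      (s.powerset.filter fun t => ((t.image eA : Finset A) : Set A) ∈ LA.lines).card := by
  rw [← Finset.card_image_of_injective _ (Finset.image_injective hA)]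
  congr 1
  ext t
  simp only [mem_linesIn, Finset.mem_image, Finset.mem_filter, Finset.mem_powerset]
  constructor
  · rintro ⟨hs, hl⟩
    obtain ⟨t', ht', rfl⟩ := Finset.subset_image_iff.mp hs
    exact ⟨t', ⟨ht', hl⟩, rfl⟩
  · rintro ⟨t', ⟨hs, hl⟩, rfl⟩
    exact ⟨Finset.image_subset_image hs, hl⟩

lemma SameLines.delta_image {A B C : Type*} {LA : LinearSpace A} {LB : LinearSpace B}
    {eA : C → A} {eB : C → B} (h : SameLines LA LB eA eB) (h3A : LA.IsTriple)
    (h3B : LB.IsTriple) (hA : Function.Injective eA) (hB : Function.Injective eB)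
    (s : Finset C) : delta LA (s.image eA) = delta LB (s.image eB) := by
  rw [h3A.delta_eq, h3B.delta_eq, Finset.card_image_of_injective _ hA,
    Finset.card_image_of_injective _ hB, card_linesIn_image LA hA, card_linesIn_image LB hB]
  simp only [h _]

lemma sameLines_of_collin {A B C : Type*} {LA : LinearSpace A} {LB : LinearSpace B}
    {eA : C → A} {eB : C → B} (h3A : LA.IsTriple)
    (h3B : LB.IsTriple) (hA : Function.Injective eA) (hB : Function.Injective eB)
    (h : ∀ x y z : C, x ≠ y → x ≠ z → y ≠ z →
      (Collin LA (eA x) (eA y) (eA z) ↔ Collin LB (eB x) (eB y) (eB z))) :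
    SameLines LA LB eA eB := by
  intro t
  by_cases ht : t.card = 3
  · obtain ⟨x, y, z, hxy, hxz, hyz, rfl⟩ := Finset.card_eq_three.mp ht
    have := h x y z hxy hxz hyz
    rw [h3A.collin_iff (hA.ne hxy) (hA.ne hxz) (hA.ne hyz),
      h3B.collin_iff (hB.ne hxy) (hB.ne hxz) (hB.ne hyz)] at this
    simpa only [Finset.image_insert, Finset.image_singleton] using this
  · constructor <;> intro hl <;> exfalso <;> apply ht
    · rw [← h3A.card_eq hl, Finset.card_image_of_injective _ hA]
    · rw [← h3B.card_eq hl, Finset.card_image_of_injective _ hB]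

lemma SameLines.collin_iff {A B C : Type*} {LA : LinearSpace A} {LB : LinearSpace B}
    {eA : C → A} {eB : C → B} (h : SameLines LA LB eA eB) (h3A : LA.IsTriple)
    (h3B : LB.IsTriple) (hA : Function.Injective eA) (hB : Function.Injective eB)
    {x y z : C} (hxy : x ≠ y) (hxz : x ≠ z) (hyz : y ≠ z) :
    Collin LA (eA x) (eA y) (eA z) ↔ Collin LB (eB x) (eB y) (eB z) := by
  have := h {x, y, z}
  rw [h3A.collin_iff (hA.ne hxy) (hA.ne hxz) (hA.ne hyz),
    h3B.collin_iff (hB.ne hxy) (hB.ne hxz) (hB.ne hyz)]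
  simpa only [Finset.image_insert, Finset.image_singleton] using this

/-- `s` is strong in the finite set `F`. -/
def StrongIn (LS : LinearSpace M) (s F : Finset M) : Prop :=
  ∀ X : Finset M, s ⊆ X → X ⊆ F → delta LS s ≤ delta LS X

lemma StrongIn.delta_inter_le {LS : LinearSpace M} (h3 : LS.IsTriple) {s F X : Finset M}
    (h : StrongIn LS s F) (hs : s ⊆ F) (hX : X ⊆ F) : delta LS (X ∩ s) ≤ delta LS X := by
  have h1 := h3.delta_union_add_inter_le X s
  have h2 := h (X ∪ s) Finset.subset_union_right (Finset.union_subset hX hs)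
  linarith

/-- `F` satisfies the sparsity condition. -/
def SparseIn (LS : LinearSpace M) (F : Finset M) : Prop :=
  ∀ S ⊆ F, (2 ≤ S.card → 2 ≤ delta LS S) ∧ (4 ≤ S.card → 3 ≤ delta LS S)

section FreeAmalgam

variable {LD : LinearSpace M} {F G : Finset M}

lemma strongIn_of_free (h3 : LD.IsTriple)
    (hline : ∀ t : Finset M, (t : Set M) ∈ LD.lines → t ⊆ F ∨ t ⊆ G)
    (hG : StrongIn LD (F ∩ G) G) : StrongIn LD F (F ∪ G) := by
  intro X hFX hX
  have hXe : F ∪ X ∩ G = X := by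
    ext x
    have h1 := @hFX x
    have h2 := @hX x
    simp only [Finset.mem_union, Finset.mem_inter] at h2 ⊢
    tauto
  have hi : F ∩ (X ∩ G) = F ∩ G := by
    ext x
    have h1 := @hFX x
    simp only [Finset.mem_inter]
    tauto
  have hm := h3.delta_union_add_inter F (X ∩ G) fun t hl hs => by
    rw [hXe] at hs
    exact (hline t hl).imp id fun h => Finset.subset_inter hs h
  rw [hXe, hi] at hm
  have := hG (X ∩ G) (by rw [← hi]; exact Finset.inter_subset_right) Finset.inter_subset_right
  linarith

lemma sparse_of_free (h3 : LD.IsTriple) (hFG : ∀ x, x ∈ F ∪ G)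
    (hline : ∀ t : Finset M, (t : Set M) ∈ LD.lines → t ⊆ F ∨ t ⊆ G)
    (hF : StrongIn LD (F ∩ G) F) (hG : StrongIn LD (F ∩ G) G)
    (hsF : SparseIn LD F) (hsG : SparseIn LD G) : SparseLS LD := by
  intro X
  set P := X ∩ F with hP
  set Q := X ∩ G with hQ
  have hXe : P ∪ Q = X := by
    rw [hP, hQ, ← Finset.inter_union_distrib_left]
    exact Finset.inter_eq_left.mpr fun x _ => hFG x
  have hm := h3.delta_union_add_inter P Q fun t hl hs => by
    rw [hXe] at hs
    exact (hline t hl).imp (Finset.subset_inter hs) (Finset.subset_inter hs)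
  have hc := Finset.card_union_add_card_inter P Q
  have hPi : P ∩ (F ∩ G) = P ∩ Q := by
    ext x
    simp only [hP, hQ, Finset.mem_inter]
    tauto
  have hQi : Q ∩ (F ∩ G) = P ∩ Q := by
    ext x
    simp only [hP, hQ, Finset.mem_inter]
    tauto
  have hPle := hF.delta_inter_le h3 (X := P) Finset.inter_subset_left Finset.inter_subset_right
  have hQle := hG.delta_inter_le h3 (X := Q) Finset.inter_subset_right Finset.inter_subset_right
  rw [hPi] at hPle
  rw [hQi] at hQle
  obtain ⟨hP2, hP4⟩ := hsF P Finset.inter_subset_right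
  obtain ⟨hQ2, hQ4⟩ := hsG Q Finset.inter_subset_right
  rw [hXe] at hm hc
  have hsP := fun h : P.card ≤ 2 => h3.delta_of_card_le_two h
  have hsQ := fun h : Q.card ≤ 2 => h3.delta_of_card_le_two h
  have hsI := fun h : (P ∩ Q).card ≤ 2 => h3.delta_of_card_le_two h
  have hIP := Finset.card_le_card (Finset.inter_subset_left (s₁ := P) (s₂ := Q))
  have hIQ := Finset.card_le_card (Finset.inter_subset_right (s₁ := P) (s₂ := Q))
  refine ⟨fun h2 => by omega, fun h4 => ?_⟩
  by_cases hclash : P.card = 3 ∧ Q.card = 3 ∧ (P ∩ Q).card = 2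
  · obtain ⟨hP3, hQ3, hI2⟩ := hclash
    by_cases hPl : (P : Set M) ∈ LD.lines
    · by_cases hQl : (Q : Set M) ∈ LD.lines
      · obtain ⟨x, y, hxy, hIe⟩ := Finset.card_eq_two.mp hI2
        have hx : x ∈ P ∩ Q := by simp [hIe]
        have hy : y ∈ P ∩ Q := by simp [hIe]
        rw [Finset.mem_inter] at hx hy
        have := Finset.coe_injective
          (LD.unique_line hxy hPl hQl hx.1 hy.1 hx.2 hy.2)
        rw [this, Finset.inter_self] at hI2
        omega
      · have := h3.delta_of_card_eq_three hQ3 hQl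
        omega
    · have := h3.delta_of_card_eq_three hP3 hPl
      omega
  · omega

end FreeAmalgam

lemma strongFin_iff [Fintype M] {LS : LinearSpace M} {s : Finset M} {S : Set M}
    (hS : S = s) : StrongFin LS S ↔ StrongIn LS s Finset.univ := by
  subst hS
  constructor
  · rintro ⟨hs, h⟩ X hX -
    rw [Finset.finite_toSet_toFinset] at h
    exact h X hX
  · intro h
    refine ⟨s.finite_toSet, ?_⟩
    rw [Finset.finite_toSet_toFinset]
    exact fun X hX => h X hX (Finset.subset_univ X)

section Transfer

variable {A D : Type*} [Fintype A] {LA : LinearSpace A} {LD : LinearSpace D} {f : A → D}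

lemma sparseIn_image (h3A : LA.IsTriple) (h3D : LD.IsTriple) (hf : Function.Injective f)
    (h : SameLines LA LD id f) (hA : SparseLS LA) : SparseIn LD (Finset.univ.image f) := by
  intro S hS
  obtain ⟨T, -, rfl⟩ := Finset.subset_image_iff.mp hS
  rw [← h.delta_image h3A h3D Function.injective_id hf, Finset.card_image_of_injective _ hf,
    Finset.image_id]
  exact hA T

lemma strongIn_image (h3A : LA.IsTriple) (h3D : LD.IsTriple) (hf : Function.Injective f)
    (h : SameLines LA LD id f) {s : Finset A} (hs : StrongIn LA s Finset.univ) :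
    StrongIn LD (s.image f) (Finset.univ.image f) := by
  intro X hX hXf
  obtain ⟨T, -, rfl⟩ := Finset.subset_image_iff.mp hXf
  rw [← h.delta_image h3A h3D Function.injective_id hf,
    ← h.delta_image h3A h3D Function.injective_id hf, Finset.image_id, Finset.image_id]
  exact hs T ((Finset.image_subset_image_iff hf).mp hX) (Finset.subset_univ T)

end Transfer

lemma exists_pushout {A B C : Type u} [Finite A] [Finite B] (eA : C → A) (eB : C → B)
    (hA : Function.Injective eA) (hB : Function.Injective eB) :
    ∃ (D : Type u) (f : A → D) (g : B → D), Finite D ∧ Function.Injective f ∧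
      Function.Injective g ∧ (∀ c, f (eA c) = g (eB c)) ∧
      (∀ a b, f a = g b → ∃ c, eA c = a ∧ eB c = b) ∧
      ∀ d, (∃ a, f a = d) ∨ ∃ b, g b = d := by
  let g : B → A ⊕ {b : B // ¬ ∃ c, eB c = b} := fun b =>
    if h : ∃ c, eB c = b then Sum.inl (eA h.choose) else Sum.inr ⟨b, h⟩
  have hg : ∀ c, g (eB c) = Sum.inl (eA c) := fun c => by
    have h : ∃ c', eB c' = eB c := ⟨c, rfl⟩
    have h' : h.choose = c := hB h.choose_spec
    simp only [g, dif_pos h, h']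
  have hg' : ∀ b (h : ¬ ∃ c, eB c = b), g b = Sum.inr ⟨b, h⟩ := fun b h => by
    simp only [g, dif_neg h]
  refine ⟨A ⊕ {b : B // ¬ ∃ c, eB c = b}, Sum.inl, g, inferInstance, Sum.inl_injective,
    ?_, fun c => (hg c).symm, ?_, ?_⟩
  · intro b b' hbb
    by_cases h : ∃ c, eB c = b <;> by_cases h' : ∃ c, eB c = b'
    · obtain ⟨c, rfl⟩ := h
      obtain ⟨c', rfl⟩ := h'
      rw [hg, hg] at hbb
      rw [hA (Sum.inl_injective hbb)]
    · obtain ⟨c, rfl⟩ := h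
      rw [hg, hg' _ h'] at hbb
      cases hbb
    · obtain ⟨c, rfl⟩ := h'
      rw [hg, hg' _ h] at hbb
      cases hbb
    · rw [hg' _ h, hg' _ h'] at hbb
      simpa using hbb
  · intro a b hab
    by_cases h : ∃ c, eB c = b
    · obtain ⟨c, rfl⟩ := h
      rw [hg] at hab
      exact ⟨c, (Sum.inl_injective hab).symm, rfl⟩
    · rw [hg' _ h] at hab
      cases hab
  · rintro (a | ⟨b, h⟩)
    · exact Or.inl ⟨a, rfl⟩
    · exact Or.inr ⟨b, hg' b h⟩

/-- Lines through a common pair of points agree on both sides: the condition under which the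
free amalgam is again a linear space. -/
def Compatible {A B C : Type*} (LA : LinearSpace A) (LB : LinearSpace B)
    (eA : C → A) (eB : C → B) : Prop :=
  ∀ c c' : C, c ≠ c' → ∀ a b, ((({eA c, eA c', a} : Finset A)) : Set A) ∈ LA.lines →
    ((({eB c, eB c', b} : Finset B)) : Set B) ∈ LB.lines → ∃ d, eA d = a ∧ eB d = b

lemma LinearSpace.IsTriple.exists_third {LS : LinearSpace M} (h : LS.IsTriple) {ℓ : Set M}
    (hl : ℓ ∈ LS.lines) {x y : M} (hx : x ∈ ℓ) (hy : y ∈ ℓ) (hxy : x ≠ y) :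
    ∃ z, ℓ = ((({x, y, z} : Finset M)) : Set M) := by
  obtain ⟨z, hz, hzn⟩ := Set.exists_mem_notMem_of_ncard_lt_ncard (s := {x, y}) (t := ℓ)
    (by rw [h ℓ hl, Set.ncard_pair hxy]; decide)
  simp only [Set.mem_insert_iff, Set.mem_singleton_iff, not_or] at hzn
  refine ⟨z, (h.eq_of_subset hl ?_ ?_).symm⟩
  · intro w hw
    simp only [Finset.coe_insert, Finset.coe_singleton, Set.mem_insert_iff,
      Set.mem_singleton_iff] at hw
    rcases hw with rfl | rfl | rfl <;> assumption
  · exact Finset.card_eq_three.mpr ⟨x, y, z, hxy, Ne.symm hzn.1, Ne.symm hzn.2, rfl⟩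

/-- The free amalgam of two linear spaces whose lines are compatible on the common part. -/
def freeAmalgam {A B D : Type*} (LA : LinearSpace A) (LB : LinearSpace B) (f : A → D) (g : B → D)
    (hf : Function.Injective f) (hg : Function.Injective g)
    (hcompat : ∀ ℓ ∈ LA.lines, ∀ ℓ' ∈ LB.lines, ∀ x y : D, x ≠ y → x ∈ f '' ℓ → y ∈ f '' ℓ →
      x ∈ g '' ℓ' → y ∈ g '' ℓ' → f '' ℓ = g '' ℓ') : LinearSpace D where
  lines := (f '' ·) '' LA.lines ∪ (g '' ·) '' LB.lines
  three_le := by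
    rintro _ (⟨ℓ, hl, rfl⟩ | ⟨ℓ, hl, rfl⟩)
    · obtain ⟨x, y, z, hx, hy, hz, hxy, hxz, hyz⟩ := LA.three_le ℓ hl
      exact ⟨f x, f y, f z, ⟨x, hx, rfl⟩, ⟨y, hy, rfl⟩, ⟨z, hz, rfl⟩,
        hf.ne hxy, hf.ne hxz, hf.ne hyz⟩
    · obtain ⟨x, y, z, hx, hy, hz, hxy, hxz, hyz⟩ := LB.three_le ℓ hl
      exact ⟨g x, g y, g z, ⟨x, hx, rfl⟩, ⟨y, hy, rfl⟩, ⟨z, hz, rfl⟩,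
        hg.ne hxy, hg.ne hxz, hg.ne hyz⟩
  unique_line := by
    rintro x y hxy _ (⟨ℓ, hl, rfl⟩ | ⟨ℓ, hl, rfl⟩) _ (⟨ℓ', hl', rfl⟩ | ⟨ℓ', hl', rfl⟩)
      hx hy hx' hy'
    · obtain ⟨a, ha, rfl⟩ := hx
      obtain ⟨b, hb, rfl⟩ := hy
      rw [hf.mem_set_image] at hx' hy'
      simp only [LA.unique_line (ne_of_apply_ne f hxy) hl hl' ha hb hx' hy']
    · exact hcompat ℓ hl ℓ' hl' x y hxy hx hy hx' hy'
    · exact (hcompat ℓ' hl' ℓ hl x y hxy hx' hy' hx hy).symm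
    · obtain ⟨a, ha, rfl⟩ := hx
      obtain ⟨b, hb, rfl⟩ := hy
      rw [hg.mem_set_image] at hx' hy'
      simp only [LB.unique_line (ne_of_apply_ne g hxy) hl hl' ha hb hx' hy']

/-- The conclusion of the amalgamation property for sparse linear spaces. -/
def HasAmalgam {A B C : Type u} (LA : LinearSpace A) (LB : LinearSpace B)
    (eA : C → A) (eB : C → B) : Prop :=
  ∃ (D : Type u) (LD : LinearSpace D) (f : A → D) (g : B → D),
    Finite D ∧ SparseLS LD ∧ IsLSEmbedding LA LD f ∧ IsLSEmbedding LB LD g ∧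
    (∀ c : C, f (eA c) = g (eB c)) ∧
    StrongFin LD (Set.range f) ∧ StrongFin LD (Set.range g)

lemma hasAmalgam_of_compatible {A B C : Type u} [Fintype A] [Fintype B] [Fintype C]
    {LA : LinearSpace A} {LB : LinearSpace B} {eA : C → A} {eB : C → B}
    (hsA : SparseLS LA) (hsB : SparseLS LB)
    (hA : Function.Injective eA) (hB : Function.Injective eB) (hsame : SameLines LA LB eA eB)
    (hstA : StrongIn LA (Finset.univ.image eA) Finset.univ)
    (hstB : StrongIn LB (Finset.univ.image eB) Finset.univ)
    (hcomp : Compatible LA LB eA eB) : HasAmalgam LA LB eA eB := by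
  have h3A := hsA.isTriple
  have h3B := hsB.isTriple
  obtain ⟨D, f, g, hD, hf, hg, hfg, hglue, hcover⟩ := exists_pushout eA eB hA hB
  have : Fintype D := Fintype.ofFinite D
  have hcompat : ∀ ℓ ∈ LA.lines, ∀ ℓ' ∈ LB.lines, ∀ x y : D, x ≠ y → x ∈ f '' ℓ → y ∈ f '' ℓ →
      x ∈ g '' ℓ' → y ∈ g '' ℓ' → f '' ℓ = g '' ℓ' := by
    rintro ℓ hl ℓ' hl' x y hxy ⟨a, ha, rfl⟩ ⟨a', ha', rfl⟩ ⟨b, hb, hab⟩ ⟨b', hb', hab'⟩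
    obtain ⟨c, rfl, rfl⟩ := hglue _ _ hab.symm
    obtain ⟨c', rfl, rfl⟩ := hglue _ _ hab'.symm
    have hcc : c ≠ c' := fun h => hxy (by rw [h])
    obtain ⟨a, rfl⟩ := h3A.exists_third hl ha ha' (hA.ne hcc)
    obtain ⟨b, rfl⟩ := h3B.exists_third hl' hb hb' (hB.ne hcc)
    obtain ⟨d, rfl, rfl⟩ := hcomp c c' hcc a b hl hl'
    simp [Set.image_insert_eq, hfg]
  let LD := freeAmalgam LA LB f g hf hg hcompat
  have h3D : LD.IsTriple := by
    rintro _ (⟨ℓ, hl, rfl⟩ | ⟨ℓ, hl, rfl⟩)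
    · simp only [Set.ncard_image_of_injective _ hf, h3A ℓ hl]
    · simp only [Set.ncard_image_of_injective _ hg, h3B ℓ hl]
  have hfL : SameLines LA LD id f := by
    intro t
    rw [Finset.image_id, Finset.coe_image]
    refine ⟨fun h => Or.inl ⟨_, h, rfl⟩, ?_⟩
    rintro (⟨ℓ, hl, he⟩ | ⟨ℓ, hl, he⟩)
    · rwa [← hf.image_injective he]
    · have hsub : t ⊆ Finset.univ.image eA := fun a ha => by
        have : f a ∈ g '' ℓ := by
          simp only at he
          rw [he]
          exact ⟨a, ha, rfl⟩
        obtain ⟨b, hb, hab⟩ := this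
        obtain ⟨c, rfl, rfl⟩ := hglue _ _ hab.symm
        simp
      obtain ⟨s, -, rfl⟩ := Finset.subset_image_iff.mp hsub
      rw [hsame s]
      have : (((s.image eB : Finset B)) : Set B) = ℓ := by
        apply hg.image_injective
        simp only at he
        rw [he, Finset.coe_image, Finset.coe_image, Set.image_image, Set.image_image]
        simp only [hfg]
      rwa [this]
  have hgL : SameLines LB LD id g := by
    intro t
    rw [Finset.image_id, Finset.coe_image]
    refine ⟨fun h => Or.inr ⟨_, h, rfl⟩, ?_⟩
    rintro (⟨ℓ, hl, he⟩ | ⟨ℓ, hl, he⟩)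
    · have hsub : t ⊆ Finset.univ.image eB := fun b hb => by
        have : g b ∈ f '' ℓ := by
          simp only at he
          rw [he]
          exact ⟨b, hb, rfl⟩
        obtain ⟨a, ha, hab⟩ := this
        obtain ⟨c, rfl, rfl⟩ := hglue _ _ hab
        simp
      obtain ⟨s, -, rfl⟩ := Finset.subset_image_iff.mp hsub
      rw [← hsame s]
      have : (((s.image eA : Finset A)) : Set A) = ℓ := by
        apply hf.image_injective
        simp only at he
        rw [he, Finset.coe_image, Finset.coe_image, Set.image_image, Set.image_image]
        simp only [hfg]
      rwa [this]
    · rwa [← hg.image_injective he]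
  set F : Finset D := Finset.univ.image f with hFdef
  set G : Finset D := Finset.univ.image g with hGdef
  have hFG : ∀ x, x ∈ F ∪ G := fun x => by
    simpa [hFdef, hGdef] using hcover x
  have hline : ∀ t : Finset D, (t : Set D) ∈ LD.lines → t ⊆ F ∨ t ⊆ G := by
    rintro t (⟨ℓ, hl, he⟩ | ⟨ℓ, hl, he⟩)
    · refine Or.inl fun x hx => ?_
      have : x ∈ f '' ℓ := by
        simp only at he
        rwa [he]
      obtain ⟨a, -, rfl⟩ := this
      simp [hFdef]
    · refine Or.inr fun x hx => ?_
      have : x ∈ g '' ℓ := by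
        simp only at he
        rwa [he]
      obtain ⟨a, -, rfl⟩ := this
      simp [hGdef]
  have hcA : (Finset.univ.image eA).image f = F ∩ G := by
    ext x
    simp only [hFdef, hGdef, Finset.mem_image, Finset.mem_inter, Finset.mem_univ, true_and]
    constructor
    · rintro ⟨_, ⟨c, rfl⟩, rfl⟩
      exact ⟨⟨_, rfl⟩, ⟨_, (hfg c).symm⟩⟩
    · rintro ⟨⟨a, rfl⟩, ⟨b, hb⟩⟩
      obtain ⟨c, rfl, -⟩ := hglue _ _ hb.symm
      exact ⟨_, ⟨c, rfl⟩, rfl⟩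
  have hcB : (Finset.univ.image eB).image g = F ∩ G := by
    rw [← hcA, Finset.image_image, Finset.image_image]
    exact Finset.image_congr fun c _ => (hfg c).symm
  have hF := strongIn_image h3A h3D hf hfL hstA
  have hG := strongIn_image h3B h3D hg hgL hstB
  rw [hcA] at hF
  rw [hcB] at hG
  have hU : F ∪ G = Finset.univ := Finset.eq_univ_iff_forall.mpr hFG
  refine ⟨D, LD, f, g, hD, ?_, ⟨hf, ?_⟩, ⟨hg, ?_⟩, hfg, ?_, ?_⟩
  · exact sparse_of_free h3D hFG hline hF hG (sparseIn_image h3A h3D hf hfL hsA)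
      (sparseIn_image h3B h3D hg hgL hsB)
  · exact fun x y z hxy hxz hyz =>
      hfL.collin_iff h3A h3D Function.injective_id hf hxy hxz hyz
  · exact fun x y z hxy hxz hyz =>
      hgL.collin_iff h3B h3D Function.injective_id hg hxy hxz hyz
  · rw [strongFin_iff (s := F) (by simp [hFdef]), ← hU]
    exact strongIn_of_free h3D hline hG
  · rw [strongFin_iff (s := G) (by simp [hGdef]), ← hU, Finset.union_comm]
    exact strongIn_of_free h3D (fun t ht => (hline t ht).symm) (by rwa [Finset.inter_comm])

section OnePoint

variable {LS : LinearSpace M} {s ℓ : Finset M} {a : M}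

lemma insert_linesIn_subset (hl : (ℓ : Set M) ∈ LS.lines) (hls : ℓ ⊆ insert a s) :
    insert ℓ (linesIn LS s) ⊆ linesIn LS (insert a s) := by
  intro t ht
  rcases Finset.mem_insert.mp ht with rfl | ht
  · exact mem_linesIn.mpr ⟨hls, hl⟩
  · obtain ⟨h1, h2⟩ := mem_linesIn.mp ht
    exact mem_linesIn.mpr ⟨h1.trans (Finset.subset_insert _ _), h2⟩

lemma notMem_linesIn (ha : a ∉ s) (hal : a ∈ ℓ) : ℓ ∉ linesIn LS s :=
  fun h => ha ((mem_linesIn.mp h).1 hal)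

variable [Fintype M]

lemma StrongIn.insert (h3 : LS.IsTriple) (hs : StrongIn LS s Finset.univ) (ha : a ∉ s)
    (hl : (ℓ : Set M) ∈ LS.lines) (hls : ℓ ⊆ insert a s) (hal : a ∈ ℓ) :
    StrongIn LS (insert a s) Finset.univ := by
  intro X hX hXu
  refine le_trans ?_ (hs X ((Finset.subset_insert _ _).trans hX) hXu)
  have := Finset.card_le_card (insert_linesIn_subset hl hls)
  rw [Finset.card_insert_of_notMem (notMem_linesIn ha hal)] at this
  rw [h3.delta_eq, h3.delta_eq, Finset.card_insert_of_notMem ha]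
  push_cast
  omega

lemma StrongIn.line_unique (h3 : LS.IsTriple) (hs : StrongIn LS s Finset.univ) (ha : a ∉ s)
    (hl : (ℓ : Set M) ∈ LS.lines) (hls : ℓ ⊆ Insert.insert a s) (hal : a ∈ ℓ) {ℓ' : Finset M}
    (hl' : (ℓ' : Set M) ∈ LS.lines) (hls' : ℓ' ⊆ Insert.insert a s) (hal' : a ∈ ℓ') : ℓ' = ℓ := by
  by_contra hne
  have hsub : Insert.insert ℓ' (Insert.insert ℓ (linesIn LS s)) ⊆
      linesIn LS (Insert.insert a s) :=
    Finset.insert_subset (mem_linesIn.mpr ⟨hls', hl'⟩) (insert_linesIn_subset hl hls)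
  have := Finset.card_le_card hsub
  rw [Finset.card_insert_of_notMem (by simp [hne, notMem_linesIn ha hal']),
    Finset.card_insert_of_notMem (notMem_linesIn ha hal)] at this
  have hd := hs (Insert.insert a s) (Finset.subset_insert _ _) (Finset.subset_univ _)
  rw [h3.delta_eq, h3.delta_eq, Finset.card_insert_of_notMem ha] at hd
  push_cast at hd
  omega

end OnePoint

/-- Extend a map by one point. -/
def extendMap {A C : Type*} (eA : C → A) (a : A) : Option C → A := fun o => o.elim a eA

section Extend

variable {A B C : Type*} {eA : C → A} {eB : C → B} {a : A} {b : B}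

lemma extendMap_injective (hA : Function.Injective eA) (ha : ∀ c, eA c ≠ a) :
    Function.Injective (extendMap eA a) := by
  rintro (_ | x) (_ | y) h
  · rfl
  · exact absurd h.symm (ha y)
  · exact absurd h (ha x)
  · exact congrArg some (hA h)

lemma image_extendMap_univ [Fintype C] :
    Finset.univ.image (extendMap eA a) = insert a (Finset.univ.image eA) := by
  ext x
  simp [extendMap, Option.exists, eq_comm]

lemma image_extendMap_some (t : Finset C) :
    (t.image some).image (extendMap eA a) = t.image eA := by
  rw [Finset.image_image]
  rfl

variable [Fintype A] [Fintype C] {LA : LinearSpace A} {LB : LinearSpace B}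

lemma extendMap_mem_lines (h3A : LA.IsTriple) (hA : Function.Injective eA)
    (hsame : SameLines LA LB eA eB) (hstA : StrongIn LA (Finset.univ.image eA) Finset.univ)
    (ha : ∀ c, eA c ≠ a) {c c' : C}
    (hla : (({eA c, eA c', a} : Finset A) : Set A) ∈ LA.lines)
    (hlb : (({eB c, eB c', b} : Finset B) : Set B) ∈ LB.lines) {t : Finset (Option C)}
    (ht : ((t.image (extendMap eA a) : Finset A) : Set A) ∈ LA.lines) :
    ((t.image (extendMap eB b) : Finset B) : Set B) ∈ LB.lines := by
  by_cases hn : none ∈ t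
  · have hpair : ({some c, some c', none} : Finset (Option C)).image (extendMap eA a) =
        {eA c, eA c', a} := by
      simp [Finset.image_insert, extendMap]
    have hu := hstA.line_unique h3A (a := a) (by simpa using ha) hla
      (by intro x; simp; rintro (rfl | rfl | rfl) <;> simp) (by simp) ht
      (by rw [← image_extendMap_univ]; exact Finset.image_subset_image (Finset.subset_univ t))
      (Finset.mem_image.mpr ⟨none, hn, rfl⟩)
    rw [← hpair] at hu
    rw [Finset.image_injective (extendMap_injective hA ha) hu]
    simpa [Finset.image_insert, extendMap] using hlb
  · have hsub : t ⊆ (Finset.univ : Finset C).image some := fun x hx => by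
      cases x with
      | none => exact absurd hx hn
      | some x => simp
    obtain ⟨s, -, rfl⟩ := Finset.subset_image_iff.mp hsub
    rw [image_extendMap_some] at ht ⊢
    exact (hsame s).mp ht

end Extend

lemma SameLines.symm {A B C : Type*} {LA : LinearSpace A} {LB : LinearSpace B}
    {eA : C → A} {eB : C → B} (h : SameLines LA LB eA eB) : SameLines LB LA eB eA :=
  fun t => (h t).symm

lemma SameLines.eq_of_line {A B C : Type*} {LA : LinearSpace A} {LB : LinearSpace B}
    {eA : C → A} {eB : C → B} (h : SameLines LA LB eA eB) (h3A : LA.IsTriple)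
    (hB : Function.Injective eB) {c c' d : C} (hcc : c ≠ c') {b : B}
    (hla : (({eA c, eA c', eA d} : Finset A) : Set A) ∈ LA.lines)
    (hlb : (({eB c, eB c', b} : Finset B) : Set B) ∈ LB.lines) : eB d = b := by
  have hlb' : (({eB c, eB c', eB d} : Finset B) : Set B) ∈ LB.lines := by
    have := h {c, c', d}
    simp only [Finset.image_insert, Finset.image_singleton] at this
    exact this.mp hla
  have he := Finset.coe_injective (LB.unique_line (hB.ne hcc) hlb hlb' (by simp) (by simp)
    (by simp) (by simp))
  have hca := h3A.card_eq hla
  have hcd : d ≠ c ∧ d ≠ c' := by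
    constructor <;> rintro rfl
    · have : ({eA d, eA c', eA d} : Finset A).card ≤ 2 := by
        rw [Finset.insert_eq_of_mem (by simp)]
        exact Finset.card_le_two
      omega
    · have : ({eA c, eA d, eA d} : Finset A).card ≤ 2 := by
        rw [Finset.pair_eq_singleton]
        exact Finset.card_le_two
      omega
  have hd : eB d ∈ ({eB c, eB c', b} : Finset B) := by
    rw [he]
    simp
  simpa [hB.ne hcd.1, hB.ne hcd.2] using hd

lemma hasAmalgam {A B : Type u} [Fintype A] [Fintype B]
    {LA : LinearSpace A} {LB : LinearSpace B} (hsA : SparseLS LA) (hsB : SparseLS LB) (n : ℕ) :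
    ∀ (C : Type u) [Fintype C] (eA : C → A) (eB : C → B),
      Fintype.card A ≤ Fintype.card C + n →
      Function.Injective eA → Function.Injective eB → SameLines LA LB eA eB →
      StrongIn LA (Finset.univ.image eA) Finset.univ →
      StrongIn LB (Finset.univ.image eB) Finset.univ → HasAmalgam LA LB eA eB := by
  have h3A := hsA.isTriple
  have h3B := hsB.isTriple
  induction n with
  | zero =>
    intro C _ eA eB hn hA hB hsame hstA hstB
    refine hasAmalgam_of_compatible hsA hsB hA hB hsame hstA hstB ?_
    intro c c' hcc a b hla hlb
    have hbij := (Fintype.bijective_iff_injective_and_card eA).mpr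
      ⟨hA, le_antisymm (Fintype.card_le_of_injective eA hA) hn⟩
    obtain ⟨d, rfl⟩ := hbij.2 a
    exact ⟨d, rfl, hsame.eq_of_line h3A hB hcc hla hlb⟩
  | succ n ih =>
    intro C _ eA eB hn hA hB hsame hstA hstB
    by_cases hcomp : Compatible LA LB eA eB
    · exact hasAmalgam_of_compatible hsA hsB hA hB hsame hstA hstB hcomp
    unfold Compatible at hcomp
    push Not at hcomp
    obtain ⟨c, c', hcc, a, b, hla, hlb, hno⟩ := hcomp
    have ha : ∀ d, eA d ≠ a := by
      rintro d rfl
      exact hno d rfl (hsame.eq_of_line h3A hB hcc hla hlb)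
    have hb : ∀ d, eB d ≠ b := by
      rintro d rfl
      exact hno d (hsame.symm.eq_of_line h3B hA hcc hlb hla) rfl
    obtain ⟨D, LD, f, g, hD, hsD, hf, hg, hfg, hF, hG⟩ :=
      ih (Option C) (extendMap eA a) (extendMap eB b)
        (by rw [Fintype.card_option]; omega) (extendMap_injective hA ha)
        (extendMap_injective hB hb)
        (fun t => ⟨extendMap_mem_lines h3A hA hsame hstA ha hla hlb,
          extendMap_mem_lines h3B hB hsame.symm hstB hb hlb hla⟩)
        (by
          rw [image_extendMap_univ]
          exact hstA.insert h3A (by simpa using ha) hla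
            (by intro x; simp; rintro (rfl | rfl | rfl) <;> simp) (by simp))
        (by
          rw [image_extendMap_univ]
          exact hstB.insert h3B (by simpa using hb) hlb
            (by intro x; simp; rintro (rfl | rfl | rfl) <;> simp) (by simp))
    exact ⟨D, LD, f, g, hD, hsD, hf, hg, fun x => hfg (some x), hF, hG⟩

/-- The class `K^sp` of finite linear spaces in which every
subset `S` with `|S| ≥ 2` has `δ(S) ≥ 2` and every subset with `|S| ≥ 4` has
`δ(S) ≥ 3` has the strong amalgamation property. -/
theorem sparse_amalgamation : AmalgProp (fun {M} LS => SparseLS (M := M) LS) := by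
  intro A B C LA LB LC hFA hFB hFC hsA hsB _ eA eB heA heB hstA hstB
  have : Fintype A := Fintype.ofFinite A
  have : Fintype B := Fintype.ofFinite B
  have : Fintype C := Fintype.ofFinite C
  refine hasAmalgam hsA hsB (Fintype.card A) C eA eB (by omega) heA.1 heB.1 ?_
    ((strongFin_iff (by simp)).mp hstA) ((strongFin_iff (by simp)).mp hstB)
  exact sameLines_of_collin hsA.isTriple hsB.isTriple heA.1 heB.1 fun x y z hxy hxz hyz =>
    (heA.2 x y z hxy hxz hyz).symm.trans (heB.2 x y z hxy hxz hyz)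
end

section
/- Let K^P be the class of finite linear spaces in which every line has exactly 3 points, every subset S satisfies δ(S) ≥ 0, and which contain no Pasch configuration (no six distinct points a,b,c,d,e,f whose collinear triples are exactly {a,b,c}, {a,d,e}, {b,d,f}, {c,e,f}). Then (K^P, ≤) has the strong amalgamation property: if A, B ∈ K^P have common induced subspace C = A ∩ B with C ≤ A and C ≤ B, then there exist D ∈ K^P and embeddings f : A → D and g : B → D agreeing on C such that f(A) ≤ D and g(B) ≤ D. -/
open scoped Classical

variable {M : Type*}

/-- A Pasch configuration in a linear space: six distinct points whose
collinear triples (lines contained in the six-point set) are exactly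
`{a,b,c}, {a,d,e}, {b,d,f}, {c,e,f}`. -/
def HasPaschLS {M : Type*} (LS : LinearSpace M) : Prop :=
  ∃ a b c d e f : M, ([a, b, c, d, e, f] : List M).Pairwise (· ≠ ·) ∧
    {ℓ ∈ LS.lines | ℓ ⊆ ({a, b, c, d, e, f} : Set M)} =
      ({ {a, b, c}, {a, d, e}, {b, d, f}, {c, e, f} } : Set (Set M))

/-- Membership in the class `K^P`: every line has exactly 3 points, every
subset has `δ(S) ≥ 0`, and there is no Pasch configuration. -/
def AntiPaschLS {M : Type*} (LS : LinearSpace M) : Prop :=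
  (∀ ℓ ∈ LS.lines, ℓ.ncard = 3) ∧ (∀ S : Finset M, 0 ≤ delta LS S) ∧
    ¬ HasPaschLS LS

namespace LinearSpace

/-- The lines of a linear space contained in a given set of points. -/
def linesIn (LS : LinearSpace M) (S : Set M) : Set (Set M) := {ℓ ∈ LS.lines | ℓ ⊆ S}

/-- The predimension of a set of points when all lines have three points. -/
noncomputable def predim (LS : LinearSpace M) (S : Set M) : ℤ :=
  (S.ncard : ℤ) - (LS.linesIn S).ncard

/-- All lines have exactly three points. -/
def ThreePointLines (LS : LinearSpace M) : Prop := ∀ ℓ ∈ LS.lines, ℓ.ncard = 3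

lemma ThreePointLines.delta_eq {LS : LinearSpace M} (h : LS.ThreePointLines) (S : Finset M) :
    delta LS S = LS.predim S := by
  unfold delta predim
  rw [Set.ncard_coe_finset]
  congr 1
  have hsub : LS.linesIn S = ↑((lineContrib_finite LS S).toFinset.filter (· ⊆ (S : Set M))) := by
    ext ℓ
    simp only [linesIn, Set.mem_ofPred_eq, Finset.coe_filter, Set.Finite.mem_toFinset, lineContrib]
    constructor
    · rintro ⟨hℓ, hs⟩
      refine ⟨⟨hℓ, ?_⟩, hs⟩
      have : ((S.filter (· ∈ ℓ) : Finset M) : Set M) = ℓ := by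
        ext x; simpa using fun hx => hs hx
      have h3 := h ℓ hℓ
      rw [← this, Set.ncard_coe_finset] at h3
      omega
    · rintro ⟨⟨hℓ, -⟩, hs⟩
      exact ⟨hℓ, hs⟩
  rw [hsub, Set.ncard_coe_finset, Finset.card_filter, Nat.cast_sum]
  refine Finset.sum_congr rfl fun ℓ hℓ => ?_
  simp only [Set.Finite.mem_toFinset, lineContrib, Set.mem_ofPred_eq] at hℓ
  have hfin : ℓ.Finite := Set.finite_of_ncard_ne_zero (by rw [h ℓ hℓ.1]; decide)
  have hle : ((S.filter (· ∈ ℓ) : Finset M) : Set M) ⊆ ℓ := fun x hx => by simp at hx; exact hx.2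
  have hcard := Set.ncard_le_ncard hle hfin
  rw [Set.ncard_coe_finset, h ℓ hℓ.1] at hcard
  split_ifs with hs
  · have : ((S.filter (· ∈ ℓ) : Finset M) : Set M) = ℓ := by
      ext x; simpa using fun hx => hs hx
    have h3 := h ℓ hℓ.1
    rw [← this, Set.ncard_coe_finset] at h3
    rw [h3]; norm_num
  · have hne : (S.filter (· ∈ ℓ)).card ≠ 3 := fun h3 => by
      have heq := Set.eq_of_subset_of_ncard_le hle
        (by rw [Set.ncard_coe_finset, h3, h ℓ hℓ.1]) hfin
      apply hs
      intro x hx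
      rw [← heq] at hx
      simp at hx
      exact hx.1
    have : (S.filter (· ∈ ℓ)).card = 2 := by omega
    rw [this]; norm_num

lemma ThreePointLines.strongFin_iff [Finite M] {LS : LinearSpace M} (h : LS.ThreePointLines)
    {s : Set M} : StrongFin LS s ↔ ∀ X, s ⊆ X → LS.predim s ≤ LS.predim X := by
  constructor
  · rintro ⟨hs, hX⟩ X hsX
    have := hX X.toFinite.toFinset (by simpa using hsX)
    simpa [h.delta_eq] using this
  · intro hX
    refine ⟨s.toFinite, fun X hsX => ?_⟩
    rw [h.delta_eq, h.delta_eq]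
    exact (by simpa using hX X (by simpa using hsX))

lemma linesIn_inter (LS : LinearSpace M) (X Y : Set M) :
    LS.linesIn (X ∩ Y) = LS.linesIn X ∩ LS.linesIn Y := by
  ext ℓ; simp only [linesIn, Set.mem_ofPred_eq, Set.subset_inter_iff, Set.mem_inter_iff]; tauto

lemma linesIn_mono (LS : LinearSpace M) {X Y : Set M} (h : X ⊆ Y) :
    LS.linesIn X ⊆ LS.linesIn Y := fun _ hℓ => ⟨hℓ.1, hℓ.2.trans h⟩

lemma predim_submodular [Finite M] (LS : LinearSpace M) (X Y : Set M) :
    LS.predim (X ∪ Y) + LS.predim (X ∩ Y) ≤ LS.predim X + LS.predim Y := by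
  have h1 := Set.ncard_union_add_ncard_inter X Y
  have h2 := Set.ncard_union_add_ncard_inter (LS.linesIn X) (LS.linesIn Y)
  have h3 : (LS.linesIn X ∪ LS.linesIn Y).ncard ≤ (LS.linesIn (X ∪ Y)).ncard :=
    Set.ncard_le_ncard (Set.union_subset (LS.linesIn_mono Set.subset_union_left)
      (LS.linesIn_mono Set.subset_union_right)) (Set.toFinite _)
  unfold predim
  rw [linesIn_inter]
  omega

lemma predim_modular [Finite M] (LS : LinearSpace M) {X Y : Set M}
    (h : ∀ ℓ ∈ LS.linesIn (X ∪ Y), ℓ ⊆ X ∨ ℓ ⊆ Y) :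
    LS.predim (X ∪ Y) + LS.predim (X ∩ Y) = LS.predim X + LS.predim Y := by
  have h1 := Set.ncard_union_add_ncard_inter X Y
  have h2 := Set.ncard_union_add_ncard_inter (LS.linesIn X) (LS.linesIn Y)
  have h3 : LS.linesIn X ∪ LS.linesIn Y = LS.linesIn (X ∪ Y) :=
    (Set.union_subset (LS.linesIn_mono Set.subset_union_left)
      (LS.linesIn_mono Set.subset_union_right)).antisymm
      fun ℓ hℓ => (h ℓ hℓ).imp (fun hX => ⟨hℓ.1, hX⟩) (fun hY => ⟨hℓ.1, hY⟩)
  unfold predim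
  rw [linesIn_inter, ← h3]
  omega

lemma predim_inter_le [Finite M] {LS : LinearSpace M} {A B : Set M} (hAB : A ∪ B = Set.univ)
    (hl : ∀ ℓ ∈ LS.lines, ℓ ⊆ A ∨ ℓ ⊆ B)
    (hB : ∀ X ⊆ B, A ∩ B ⊆ X → LS.predim (A ∩ B) ≤ LS.predim X) (S : Set M) :
    LS.predim (S ∩ A) ≤ LS.predim S := by
  have hS : S ∩ A ∪ S ∩ B = S := by rw [← Set.inter_union_distrib_left, hAB, Set.inter_univ]
  have h1 := LS.predim_modular (X := S ∩ A) (Y := S ∩ B) fun ℓ hℓ => by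
    rw [hS] at hℓ
    exact (hl ℓ hℓ.1).imp (Set.subset_inter hℓ.2) (Set.subset_inter hℓ.2)
  have h2 := LS.predim_submodular (S ∩ B) (A ∩ B)
  have h3 := hB (S ∩ B ∪ A ∩ B) (Set.union_subset Set.inter_subset_right Set.inter_subset_right)
    Set.subset_union_right
  have h4 : S ∩ A ∩ (S ∩ B) = S ∩ B ∩ (A ∩ B) := by ext; simp; tauto
  rw [hS, h4] at h1
  linarith

lemma eq_of_mem_linesIn_insert [Finite M] {LS : LinearSpace M} {C : Set M} {p : M} (hp : p ∉ C)
    (hC : LS.predim C ≤ LS.predim (insert p C)) {ℓ₁ ℓ₂ : Set M}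
    (h₁ : ℓ₁ ∈ LS.linesIn (insert p C)) (h₂ : ℓ₂ ∈ LS.linesIn (insert p C))
    (hp₁ : p ∈ ℓ₁) (hp₂ : p ∈ ℓ₂) : ℓ₁ = ℓ₂ := by
  by_contra hne
  have hd : Disjoint (LS.linesIn C) {ℓ₁, ℓ₂} := by
    rw [Set.disjoint_left]
    rintro ℓ hℓ (rfl | rfl)
    exacts [hp (hℓ.2 hp₁), hp (hℓ.2 hp₂)]
  have h1 := Set.ncard_union_eq hd (Set.toFinite _) (Set.toFinite _)
  rw [Set.ncard_pair hne] at h1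
  have h2 : (LS.linesIn C ∪ {ℓ₁, ℓ₂}).ncard ≤ (LS.linesIn (insert p C)).ncard := by
    refine Set.ncard_le_ncard (Set.union_subset (LS.linesIn_mono (Set.subset_insert _ _)) ?_)
      (Set.toFinite _)
    rintro ℓ (rfl | rfl) <;> assumption
  have h3 := Set.ncard_insert_of_notMem hp (Set.toFinite _)
  unfold predim at hC
  omega

lemma predim_insert_le [Finite M] {LS : LinearSpace M} {C : Set M} {p : M} (hp : p ∉ C)
    {ℓ : Set M} (h : ℓ ∈ LS.linesIn (insert p C)) (hpl : p ∈ ℓ) :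
    LS.predim (insert p C) ≤ LS.predim C := by
  have h1 := Set.ncard_insert_of_notMem (s := LS.linesIn C) (a := ℓ) (fun h' => hp (h'.2 hpl))
    (Set.toFinite _)
  have h2 : (insert ℓ (LS.linesIn C)).ncard ≤ (LS.linesIn (insert p C)).ncard :=
    Set.ncard_le_ncard (Set.insert_subset h (LS.linesIn_mono (Set.subset_insert _ _)))
      (Set.toFinite _)
  have h3 := Set.ncard_insert_of_notMem hp (Set.toFinite _)
  unfold predim
  omega

lemma ThreePointLines.eq_triple {LS : LinearSpace M} (h : LS.ThreePointLines) {ℓ : Set M}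
    (hℓ : ℓ ∈ LS.lines) {x y z : M} (hx : x ∈ ℓ) (hy : y ∈ ℓ) (hz : z ∈ ℓ)
    (hxy : x ≠ y) (hxz : x ≠ z) (hyz : y ≠ z) : ℓ = {x, y, z} := by
  have hfin : ℓ.Finite := Set.finite_of_ncard_ne_zero (by rw [h ℓ hℓ]; decide)
  refine (Set.eq_of_subset_of_ncard_le ?_ ?_ hfin).symm
  · rintro w (rfl | rfl | rfl) <;> assumption
  · rw [h ℓ hℓ, Set.ncard_eq_three.2 ⟨x, y, z, hxy, hxz, hyz, rfl⟩]

lemma ThreePointLines.collin_iff {LS : LinearSpace M} (h : LS.ThreePointLines) {x y z : M}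
    (hxy : x ≠ y) (hxz : x ≠ z) (hyz : y ≠ z) : Collin LS x y z ↔ {x, y, z} ∈ LS.lines := by
  constructor
  · rintro ⟨ℓ, hℓ, hx, hy, hz⟩
    rwa [← h.eq_triple hℓ hx hy hz hxy hxz hyz]
  · exact fun hl => ⟨_, hl, by simp, by simp, by simp⟩

lemma image_mem_lines_iff {A D : Type*} {LA : LinearSpace A} {LD : LinearSpace D}
    (hA : LA.ThreePointLines) (hD : LD.ThreePointLines) {f : A → D} (hf : IsLSEmbedding LA LD f)
    {ℓ : Set A} : f '' ℓ ∈ LD.lines ↔ ℓ ∈ LA.lines := by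
  have key (h3 : ℓ.ncard = 3) : f '' ℓ ∈ LD.lines ↔ ℓ ∈ LA.lines := by
    obtain ⟨x, y, z, hxy, hxz, hyz, rfl⟩ := Set.ncard_eq_three.1 h3
    have := hf.2 x y z hxy hxz hyz
    rw [hA.collin_iff hxy hxz hyz, hD.collin_iff (hf.1.ne hxy) (hf.1.ne hxz) (hf.1.ne hyz)] at this
    rw [this]; simp [Set.image_insert_eq]
  constructor
  · intro h
    exact (key (by rw [← Set.ncard_image_of_injective _ hf.1, hD _ h])).1 h
  · exact fun h => (key (hA _ h)).2 h

lemma linesIn_image {A D : Type*} {LA : LinearSpace A} {LD : LinearSpace D}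
    (hA : LA.ThreePointLines) (hD : LD.ThreePointLines) {f : A → D} (hf : IsLSEmbedding LA LD f)
    (S : Set A) : LD.linesIn (f '' S) = Set.image f '' LA.linesIn S := by
  ext ℓ
  constructor
  · rintro ⟨hℓ, hs⟩
    obtain ⟨t, ht, rfl⟩ := Set.subset_image_iff.1 hs
    exact ⟨t, ⟨(image_mem_lines_iff hA hD hf).1 hℓ, ht⟩, rfl⟩
  · rintro ⟨t, ⟨ht, hs⟩, rfl⟩
    exact ⟨(image_mem_lines_iff hA hD hf).2 ht, Set.image_mono hs⟩

lemma predim_image {A D : Type*} {LA : LinearSpace A} {LD : LinearSpace D}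
    (hA : LA.ThreePointLines) (hD : LD.ThreePointLines) {f : A → D} (hf : IsLSEmbedding LA LD f)
    (S : Set A) : LD.predim (f '' S) = LA.predim S := by
  unfold predim
  rw [linesIn_image hA hD hf, Set.ncard_image_of_injective _ hf.1,
    Set.ncard_image_of_injective _ hf.1.image_injective]

lemma hasPaschLS_of_image {A D : Type*} {LA : LinearSpace A} {LD : LinearSpace D}
    (hA : LA.ThreePointLines) (hD : LD.ThreePointLines) {f : A → D} (hf : IsLSEmbedding LA LD f)
    {a b c d e k : A} (hne : ([f a, f b, f c, f d, f e, f k] : List D).Pairwise (· ≠ ·))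
    (h : LD.linesIn {f a, f b, f c, f d, f e, f k} =
      {{f a, f b, f c}, {f a, f d, f e}, {f b, f d, f k}, {f c, f e, f k}}) :
    HasPaschLS LA := by
  refine ⟨a, b, c, d, e, k, ?_, ?_⟩
  · have : ([a, b, c, d, e, k].map f).Pairwise (· ≠ ·) := hne
    rw [List.pairwise_map] at this
    exact this.imp fun h heq => h (congrArg f heq)
  · have h1 := linesIn_image hA hD hf {a, b, c, d, e, k}
    simp only [Set.image_insert_eq, Set.image_singleton] at h1
    rw [h] at h1
    apply hf.1.image_injective.image_injective
    change Set.image f '' LA.linesIn _ = _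
    rw [← h1]
    simp [Set.image_insert_eq]

/-- In a space which is a union of two sets containing every line between them and having a strong
intersection, every Pasch configuration lies in one of the two sets. -/
lemma pasch_subset_or_subset [Finite M] {LS : LinearSpace M} {A B : Set M}
    (hl : ∀ ℓ ∈ LS.lines, ℓ ⊆ A ∨ ℓ ⊆ B)
    (hA : ∀ X ⊆ A, A ∩ B ⊆ X → LS.predim (A ∩ B) ≤ LS.predim X)
    (hB : ∀ X ⊆ B, A ∩ B ⊆ X → LS.predim (A ∩ B) ≤ LS.predim X)
    {a b c d e f : M} (hne : ([a, b, c, d, e, f] : List M).Pairwise (· ≠ ·))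
    (h₁ : {a, b, c} ∈ LS.lines) (h₂ : {a, d, e} ∈ LS.lines) (h₃ : {b, d, f} ∈ LS.lines)
    (h₄ : {c, e, f} ∈ LS.lines) :
    ({a, b, c, d, e, f} : Set M) ⊆ A ∨ ({a, b, c, d, e, f} : Set M) ⊆ B := by
  have key {p : M} (h : (p ∈ A ∧ p ∉ B) ∨ (p ∈ B ∧ p ∉ A)) {ℓ₁ ℓ₂ : Set M} (h₁ : ℓ₁ ∈ LS.lines)
      (h₂ : ℓ₂ ∈ LS.lines) (hp₁ : p ∈ ℓ₁) (hp₂ : p ∈ ℓ₂) (hs₁ : ℓ₁ ⊆ insert p (A ∩ B))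
      (hs₂ : ℓ₂ ⊆ insert p (A ∩ B)) : ℓ₁ = ℓ₂ := by
    refine eq_of_mem_linesIn_insert (fun hp => ?_) ?_ ⟨h₁, hs₁⟩ ⟨h₂, hs₂⟩ hp₁ hp₂
    · have := hp.1; have := hp.2; tauto
    · rcases h with h | h
      · exact hA _ (Set.insert_subset h.1 Set.inter_subset_left) (Set.subset_insert _ _)
      · exact hB _ (Set.insert_subset h.1 Set.inter_subset_right) (Set.subset_insert _ _)
  have pair {p q r s t : M} (h₁ : {p, q, r} ∈ LS.lines) (h₂ : {p, s, t} ∈ LS.lines)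
      (hq : q ≠ p) (hqs : q ≠ s) (hqt : q ≠ t)
      (hqA : q ∈ A) (hqB : q ∈ B) (hrA : r ∈ A) (hrB : r ∈ B) (hsA : s ∈ A) (hsB : s ∈ B)
      (htA : t ∈ A) (htB : t ∈ B) : (p ∈ A ↔ p ∈ B) := by
    by_contra hcon
    have := key (p := p) (by tauto) h₁ h₂ (by simp) (by simp)
      (by simp [Set.insert_subset_iff, *]) (by simp [Set.insert_subset_iff, *])
    have hmem : q ∈ ({p, s, t} : Set M) := this ▸ (by simp)
    simp [hq, hqs, hqt] at hmem
  simp only [List.pairwise_cons, List.mem_cons, List.not_mem_nil, or_false, forall_eq_or_imp,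
    forall_eq, ne_eq] at hne
  have r {x y z : M} (h : {x, y, z} ∈ LS.lines) : {y, x, z} ∈ LS.lines := by
    rwa [Set.insert_comm]
  have s {x y z : M} (h : {x, y, z} ∈ LS.lines) : {z, x, y} ∈ LS.lines := by
    rwa [Set.insert_comm, Set.pair_comm z y]
  have pa := pair h₁ h₂ (by tauto) (by tauto) (by tauto)
  have pb := pair (r h₁) h₃ (by tauto) (by tauto) (by tauto)
  have pc := pair (s h₁) h₄ (by tauto) (by tauto) (by tauto)
  have pd := pair (r h₂) (r h₃) (by tauto) (by tauto) (by tauto)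
  have pe := pair (s h₂) (r h₄) (by tauto) (by tauto) (by tauto)
  have pf := pair (s h₃) (s h₄) (by tauto) (by tauto) (by tauto)
  have l₁ := hl _ h₁
  have l₂ := hl _ h₂
  have l₃ := hl _ h₃
  have l₄ := hl _ h₄
  simp only [Set.insert_subset_iff, Set.singleton_subset_iff] at l₁ l₂ l₃ l₄ ⊢
  clear hne key pair hl hA hB h₁ h₂ h₃ h₄ r s
  grind

lemma image_mem_lines_of_collin_iff {A B C : Type*} {LA : LinearSpace A} {LB : LinearSpace B}
    (hA : LA.ThreePointLines) (hB : LB.ThreePointLines) {eA : C → A} {eB : C → B}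
    (iA : Function.Injective eA) (iB : Function.Injective eB)
    (hC : ∀ x y z, x ≠ y → x ≠ z → y ≠ z →
      (Collin LA (eA x) (eA y) (eA z) ↔ Collin LB (eB x) (eB y) (eB z)))
    {ℓ : Set C} (hℓ : eA '' ℓ ∈ LA.lines) : eB '' ℓ ∈ LB.lines := by
  have h3 : ℓ.ncard = 3 := by rw [← Set.ncard_image_of_injective _ iA, hA _ hℓ]
  obtain ⟨x, y, z, hxy, hxz, hyz, rfl⟩ := Set.ncard_eq_three.1 h3
  have := hC x y z hxy hxz hyz
  rw [hA.collin_iff (iA.ne hxy) (iA.ne hxz) (iA.ne hyz),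
    hB.collin_iff (iB.ne hxy) (iB.ne hxz) (iB.ne hyz)] at this
  simp only [Set.image_insert_eq, Set.image_singleton] at hℓ ⊢
  exact this.1 hℓ

/-- The lines of a free amalgam of two linear spaces form a linear space, if no line through two
common points has a third point outside of the common part in both spaces. -/
def amalgam {A B C D : Type*} (LA : LinearSpace A) (LB : LinearSpace B)
    (hA : LA.ThreePointLines) (hB : LB.ThreePointLines) (eA : C → A) (eB : C → B)
    (iA : Function.Injective eA) (iB : Function.Injective eB)
    (hC : ∀ x y z, x ≠ y → x ≠ z → y ≠ z →
      (Collin LA (eA x) (eA y) (eA z) ↔ Collin LB (eB x) (eB y) (eB z)))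
    (hN : ∀ m₁ ∈ LA.lines, ∀ m₂ ∈ LB.lines, ∀ c₁ c₂, c₁ ≠ c₂ → eA c₁ ∈ m₁ → eA c₂ ∈ m₁ →
      eB c₁ ∈ m₂ → eB c₂ ∈ m₂ → m₁ ⊆ Set.range eA ∨ m₂ ⊆ Set.range eB)
    (f : A → D) (g : B → D) (iF : Function.Injective f) (iG : Function.Injective g)
    (hfg : ∀ c, f (eA c) = g (eB c)) (hmeet : ∀ a b, f a = g b → ∃ c, eA c = a ∧ eB c = b) :
    LinearSpace D where
  lines := Set.image f '' LA.lines ∪ Set.image g '' LB.lines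
  three_le := by
    rintro _ (⟨m, hm, rfl⟩ | ⟨m, hm, rfl⟩)
    · obtain ⟨x, y, z, hx, hy, hz, hxy, hxz, hyz⟩ := LA.three_le m hm
      exact ⟨f x, f y, f z, ⟨x, hx, rfl⟩, ⟨y, hy, rfl⟩, ⟨z, hz, rfl⟩, iF.ne hxy, iF.ne hxz,
        iF.ne hyz⟩
    · obtain ⟨x, y, z, hx, hy, hz, hxy, hxz, hyz⟩ := LB.three_le m hm
      exact ⟨g x, g y, g z, ⟨x, hx, rfl⟩, ⟨y, hy, rfl⟩, ⟨z, hz, rfl⟩, iG.ne hxy, iG.ne hxz,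
        iG.ne hyz⟩
  unique_line := by
    have mixed : ∀ ⦃x y : D⦄, x ≠ y → ∀ m₁ ∈ LA.lines, ∀ m₂ ∈ LB.lines, x ∈ f '' m₁ →
        y ∈ f '' m₁ → x ∈ g '' m₂ → y ∈ g '' m₂ → f '' m₁ = g '' m₂ := by
      rintro _ _ hxy m₁ h₁ m₂ h₂ ⟨x, hx, rfl⟩ ⟨y, hy, rfl⟩ ⟨x', hx', hxx⟩ ⟨y', hy', hyy⟩
      obtain ⟨c₁, rfl, rfl⟩ := hmeet _ _ hxx.symm
      obtain ⟨c₂, rfl, rfl⟩ := hmeet _ _ hyy.symm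
      have hcc : c₁ ≠ c₂ := fun h => hxy (by rw [h])
      have himg (ℓ : Set C) : f '' (eA '' ℓ) = g '' (eB '' ℓ) := by
        simp only [Set.image_image, hfg]
      rcases hN m₁ h₁ m₂ h₂ c₁ c₂ hcc hx hy hx' hy' with h | h
      · obtain ⟨ℓ, rfl⟩ := Set.subset_range_iff_exists_image_eq.1 h
        rw [himg, LB.unique_line (iB.ne hcc) (image_mem_lines_of_collin_iff hA hB iA iB hC h₁) h₂
          (Set.mem_image_of_mem _ (iA.mem_set_image.1 hx))
          (Set.mem_image_of_mem _ (iA.mem_set_image.1 hy)) hx' hy']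
      · obtain ⟨ℓ, rfl⟩ := Set.subset_range_iff_exists_image_eq.1 h
        rw [← himg, LA.unique_line (iA.ne hcc) (image_mem_lines_of_collin_iff hB hA iB iA
          (fun x y z hxy hxz hyz => (hC x y z hxy hxz hyz).symm) h₂) h₁
          (Set.mem_image_of_mem _ (iB.mem_set_image.1 hx'))
          (Set.mem_image_of_mem _ (iB.mem_set_image.1 hy')) hx hy]
    rintro x y hxy _ (⟨m₁, h₁, rfl⟩ | ⟨m₁, h₁, rfl⟩) _ (⟨m₂, h₂, rfl⟩ | ⟨m₂, h₂, rfl⟩) hx hy hx' hy'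
    · obtain ⟨x, hx, rfl⟩ := hx
      obtain ⟨y, hy, rfl⟩ := hy
      rw [LA.unique_line (fun h => hxy (by rw [h])) h₁ h₂ hx hy (iF.mem_set_image.1 hx')
        (iF.mem_set_image.1 hy')]
    · exact mixed hxy _ h₁ _ h₂ hx hy hx' hy'
    · exact (mixed hxy _ h₂ _ h₁ hx' hy' hx hy).symm
    · obtain ⟨x, hx, rfl⟩ := hx
      obtain ⟨y, hy, rfl⟩ := hy
      rw [LB.unique_line (fun h => hxy (by rw [h])) h₁ h₂ hx hy (iG.mem_set_image.1 hx')
        (iG.mem_set_image.1 hy')]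

/-- The inclusion of one part into a space whose lines are those of the two parts. -/
lemma isLSEmbedding_of_lines_eq {A B C D : Type*} {LA : LinearSpace A} {LB : LinearSpace B}
    {LD : LinearSpace D} {eA : C → A} {eB : C → B}
    (hC : ∀ x y z, x ≠ y → x ≠ z → y ≠ z →
      (Collin LA (eA x) (eA y) (eA z) ↔ Collin LB (eB x) (eB y) (eB z)))
    {f : A → D} {g : B → D} (iF : Function.Injective f)
    (hmeet : ∀ a b, f a = g b → ∃ c, eA c = a ∧ eB c = b)
    (hD : LD.lines = Set.image f '' LA.lines ∪ Set.image g '' LB.lines) :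
    IsLSEmbedding LA LD f := by
  refine ⟨iF, fun x y z hxy hxz hyz => ⟨?_, ?_⟩⟩
  · rintro ⟨ℓ, hℓ, hx, hy, hz⟩
    exact ⟨f '' ℓ, hD ▸ Or.inl ⟨ℓ, hℓ, rfl⟩, ⟨x, hx, rfl⟩, ⟨y, hy, rfl⟩, ⟨z, hz, rfl⟩⟩
  · rintro ⟨ℓ, hℓ, hx, hy, hz⟩
    rw [hD] at hℓ
    rcases hℓ with ⟨ℓ, hℓ, rfl⟩ | ⟨ℓ, hℓ, rfl⟩
    · exact ⟨ℓ, hℓ, iF.mem_set_image.1 hx, iF.mem_set_image.1 hy, iF.mem_set_image.1 hz⟩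
    · obtain ⟨x', hx, hxx⟩ := hx
      obtain ⟨y', hy, hyy⟩ := hy
      obtain ⟨z', hz, hzz⟩ := hz
      obtain ⟨c₁, rfl, rfl⟩ := hmeet _ _ hxx.symm
      obtain ⟨c₂, rfl, rfl⟩ := hmeet _ _ hyy.symm
      obtain ⟨c₃, rfl, rfl⟩ := hmeet _ _ hzz.symm
      exact (hC c₁ c₂ c₃ (fun h => hxy (by rw [h])) (fun h => hxz (by rw [h]))
        (fun h => hyz (by rw [h]))).2 ⟨ℓ, hℓ, hx, hy, hz⟩

/-- A strong subspace remains strong after adding a point on a line through two of its points. -/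
lemma predim_range_elim_le {A C : Type*} [Finite A] {LA : LinearSpace A} {eA : C → A}
    (hs : ∀ X, Set.range eA ⊆ X → LA.predim (Set.range eA) ≤ LA.predim X) {a : A}
    (ha : a ∉ Set.range eA) {ℓ : Set A} (hℓ : ℓ ∈ LA.lines) (hal : a ∈ ℓ)
    (hsub : ℓ ⊆ insert a (Set.range eA)) (X : Set A)
    (hX : Set.range (fun o : Option C => o.elim a eA) ⊆ X) :
    LA.predim (Set.range fun o : Option C => o.elim a eA) ≤ LA.predim X := by
  have hr : (Set.range fun o : Option C => o.elim a eA) = insert a (Set.range eA) := by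
    ext x; simp [Option.exists, eq_comm]
  rw [hr] at hX ⊢
  exact (predim_insert_le ha ⟨hℓ, hsub⟩ hal).trans (hs X ((Set.subset_insert _ _).trans hX))

lemma collin_swap {LS : LinearSpace M} {x y z : M} : Collin LS x y z ↔ Collin LS y x z := by
  unfold Collin; constructor <;> rintro ⟨l, h, h1, h2, h3⟩ <;> exact ⟨l, h, h2, h1, h3⟩

lemma collin_rotate {LS : LinearSpace M} {x y z : M} : Collin LS x y z ↔ Collin LS z x y := by
  unfold Collin
  constructor
  · rintro ⟨l, h, h1, h2, h3⟩
    exact ⟨l, h, h3, h1, h2⟩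
  · rintro ⟨l, h, h1, h2, h3⟩
    exact ⟨l, h, h2, h3, h1⟩

/-- If an outer point `a` lies on a line with two points of a strong subspace, then this is its only
line through two such points, so a point `b` on the corresponding line of another space satisfies
all collinearities of `a`. -/
lemma collin_transfer {A B C : Type*} [Finite A] {LA : LinearSpace A} {LB : LinearSpace B}
    (hA : LA.ThreePointLines) {eA : C → A} {eB : C → B} (iA : Function.Injective eA)
    (hs : ∀ X, Set.range eA ⊆ X → LA.predim (Set.range eA) ≤ LA.predim X) {a : A} {b : B}
    (ha : a ∉ Set.range eA) {c₁ c₂ : C} (h₁ : {a, eA c₁, eA c₂} ∈ LA.lines)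
    (h₂ : {b, eB c₁, eB c₂} ∈ LB.lines) {x y : C} (hxy : x ≠ y)
    (h : Collin LA a (eA x) (eA y)) : Collin LB b (eB x) (eB y) := by
  have hax (c : C) : a ≠ eA c := fun h => ha ⟨c, h.symm⟩
  rw [hA.collin_iff (hax x) (hax y) (iA.ne hxy)] at h
  have heq := eq_of_mem_linesIn_insert ha (hs _ (Set.subset_insert _ _))
    ⟨h, by simp [Set.insert_subset_iff]⟩ ⟨h₁, by simp [Set.insert_subset_iff]⟩
    (by simp) (by simp)
  have hx : eA x ∈ ({a, eA c₁, eA c₂} : Set A) := heq ▸ by simp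
  have hy : eA y ∈ ({a, eA c₁, eA c₂} : Set A) := heq ▸ by simp
  simp only [Set.mem_insert_iff, (hax _).symm, Set.mem_singleton_iff, iA.eq_iff, false_or] at hx hy
  refine ⟨_, h₂, by simp, ?_, ?_⟩
  · rcases hx with rfl | rfl <;> simp
  · rcases hy with rfl | rfl <;> simp

lemma predim_le_of_subset_range {A D : Type*} {LA : LinearSpace A} {LD : LinearSpace D}
    (hA : LA.ThreePointLines) (hD : LD.ThreePointLines) {f : A → D} (hf : IsLSEmbedding LA LD f)
    {S : Set A} (hs : ∀ X, S ⊆ X → LA.predim S ≤ LA.predim X) :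
    ∀ X ⊆ Set.range f, f '' S ⊆ X → LD.predim (f '' S) ≤ LD.predim X := by
  intro X hX hSX
  obtain ⟨Y, rfl⟩ := Set.subset_range_iff_exists_image_eq.1 hX
  rw [predim_image hA hD hf, predim_image hA hD hf]
  exact hs Y ((Set.image_subset_image_iff hf.1).1 hSX)

lemma exists_free_amalgam {A B : Type u} [Finite A] [Finite B] {LA : LinearSpace A}
    {LB : LinearSpace B} (hA : AntiPaschLS LA) (hB : AntiPaschLS LB) {C : Type u}
    {eA : C → A} {eB : C → B} (iA : Function.Injective eA) (iB : Function.Injective eB)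
    (hC : ∀ x y z, x ≠ y → x ≠ z → y ≠ z →
      (Collin LA (eA x) (eA y) (eA z) ↔ Collin LB (eB x) (eB y) (eB z)))
    (sA : ∀ X, Set.range eA ⊆ X → LA.predim (Set.range eA) ≤ LA.predim X)
    (sB : ∀ X, Set.range eB ⊆ X → LB.predim (Set.range eB) ≤ LB.predim X)
    (hN : ∀ m₁ ∈ LA.lines, ∀ m₂ ∈ LB.lines, ∀ c₁ c₂, c₁ ≠ c₂ → eA c₁ ∈ m₁ → eA c₂ ∈ m₁ →
      eB c₁ ∈ m₂ → eB c₂ ∈ m₂ → m₁ ⊆ Set.range eA ∨ m₂ ⊆ Set.range eB) :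
      ∃ (D : Type u) (LD : LinearSpace D) (f : A → D) (g : B → D),
        Finite D ∧ AntiPaschLS LD ∧ IsLSEmbedding LA LD f ∧ IsLSEmbedding LB LD g ∧
        (∀ c : C, f (eA c) = g (eB c)) ∧
        StrongFin LD (Set.range f) ∧ StrongFin LD (Set.range g) := by
  obtain ⟨D, f, g, _, iF, iG, hfg, hmeet, hcover⟩ : ∃ (D : Type u) (f : A → D) (g : B → D),
      Finite D ∧ Function.Injective f ∧ Function.Injective g ∧ (∀ c, f (eA c) = g (eB c)) ∧
      (∀ a b, f a = g b → ∃ c, eA c = a ∧ eB c = b) ∧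
      Set.range f ∪ Set.range g = Set.univ := by
    have hg (c : C) (h : ∃ c', eB c' = eB c) : h.choose = c := iB h.choose_spec
    refine ⟨A ⊕ {b : B // ¬ ∃ c, eB c = b}, Sum.inl,
      fun b => if h : ∃ c, eB c = b then Sum.inl (eA h.choose) else Sum.inr ⟨b, h⟩,
      inferInstance, Sum.inl_injective, ?_, ?_, ?_, ?_⟩
    · intro b b' h
      dsimp only at h
      split_ifs at h with h₁ h₂ h₂
      · rw [← h₁.choose_spec, ← h₂.choose_spec, iA (Sum.inl_injective h)]
      · exact congrArg Subtype.val (Sum.inr_injective h)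
    · intro c
      have h : ∃ c', eB c' = eB c := ⟨c, rfl⟩
      simp only [dif_pos h, hg c h]
    · intro a b h
      dsimp only at h
      split_ifs at h with h₁
      exact ⟨_, (Sum.inl_injective h).symm, h₁.choose_spec⟩
    · rw [Set.eq_univ_iff_forall]
      rintro (a | ⟨b, hb⟩)
      · exact Or.inl ⟨a, rfl⟩
      · exact Or.inr ⟨b, by simp only [dif_neg hb]⟩
  have tA : LA.ThreePointLines := hA.1
  have tB : LB.ThreePointLines := hB.1
  let LD : LinearSpace D := amalgam LA LB tA tB eA eB iA iB hC hN f g iF iG hfg hmeet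
  have hL : LD.lines = Set.image f '' LA.lines ∪ Set.image g '' LB.lines := rfl
  have hf : IsLSEmbedding LA LD f := isLSEmbedding_of_lines_eq hC iF hmeet hL
  have hg : IsLSEmbedding LB LD g := isLSEmbedding_of_lines_eq
    (fun x y z hxy hxz hyz => (hC x y z hxy hxz hyz).symm) iG
    (fun b a h => (hmeet a b h.symm).imp fun _ h => h.symm) (hL.trans (Set.union_comm _ _))
  have tD : LD.ThreePointLines := by
    rintro _ (⟨ℓ, hℓ, rfl⟩ | ⟨ℓ, hℓ, rfl⟩)
    · rw [Set.ncard_image_of_injective _ iF, tA ℓ hℓ]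
    · rw [Set.ncard_image_of_injective _ iG, tB ℓ hℓ]
  have hl : ∀ ℓ ∈ LD.lines, ℓ ⊆ Set.range f ∨ ℓ ⊆ Set.range g := by
    rintro _ (⟨ℓ, hℓ, rfl⟩ | ⟨ℓ, hℓ, rfl⟩)
    exacts [Or.inl (Set.image_subset_range _ _), Or.inr (Set.image_subset_range _ _)]
  have interA : Set.range f ∩ Set.range g = f '' Set.range eA := by
    ext d
    constructor
    · rintro ⟨⟨a, rfl⟩, b, h⟩
      obtain ⟨c, rfl, -⟩ := hmeet a b h.symm
      exact ⟨_, ⟨c, rfl⟩, rfl⟩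
    · rintro ⟨_, ⟨c, rfl⟩, rfl⟩
      exact ⟨⟨_, rfl⟩, _, (hfg c).symm⟩
  have interB : Set.range f ∩ Set.range g = g '' Set.range eB := by
    rw [interA, ← Set.range_comp, ← Set.range_comp]
    exact congrArg Set.range (funext hfg)
  have strA : ∀ X ⊆ Set.range f, Set.range f ∩ Set.range g ⊆ X →
      LD.predim (Set.range f ∩ Set.range g) ≤ LD.predim X := by
    rw [interA]; exact predim_le_of_subset_range tA tD hf sA
  have strB : ∀ X ⊆ Set.range g, Set.range f ∩ Set.range g ⊆ X →
      LD.predim (Set.range f ∩ Set.range g) ≤ LD.predim X := by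
    rw [interB]; exact predim_le_of_subset_range tB tD hg sB
  have leA := predim_inter_le hcover hl strB
  have leB := predim_inter_le (LS := LD) (A := Set.range g) (B := Set.range f)
    (by rwa [Set.union_comm]) (fun ℓ hℓ => (hl ℓ hℓ).symm) (by rwa [Set.inter_comm])
  refine ⟨D, LD, f, g, inferInstance, ⟨tD, fun S => ?_, ?_⟩, hf, hg, hfg, ?_, ?_⟩
  · rw [tD.delta_eq]
    refine le_trans ?_ (leA S)
    obtain ⟨Y, hY⟩ := Set.subset_range_iff_exists_image_eq.1
      (Set.inter_subset_right : (S : Set D) ∩ Set.range f ⊆ Set.range f)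
    rw [← hY, predim_image tA tD hf]
    have := hA.2.1 Y.toFinite.toFinset
    rwa [tA.delta_eq, Set.Finite.coe_toFinset] at this
  · rintro ⟨a, b, c, d, e, k, hne, h⟩
    have mem : ∀ ℓ ∈ ({{a, b, c}, {a, d, e}, {b, d, k}, {c, e, k}} : Set (Set D)),
        ℓ ∈ LD.lines := fun ℓ hℓ => by
      rw [← h] at hℓ; exact hℓ.1
    rcases pasch_subset_or_subset hl strA strB hne (mem _ (by simp)) (mem _ (by simp))
      (mem _ (by simp)) (mem _ (by simp)) with hs | hs <;>
    simp only [Set.insert_subset_iff, Set.singleton_subset_iff, Set.mem_range] at hs <;>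
    obtain ⟨⟨a, rfl⟩, ⟨b, rfl⟩, ⟨c, rfl⟩, ⟨d, rfl⟩, ⟨e, rfl⟩, ⟨k, rfl⟩⟩ := hs
    · exact hA.2.2 (hasPaschLS_of_image tA tD hf hne h)
    · exact hB.2.2 (hasPaschLS_of_image tB tD hg hne h)
  · rw [tD.strongFin_iff]
    intro X hX
    simpa [Set.inter_eq_self_of_subset_right hX] using leA X
  · rw [tD.strongFin_iff]
    intro X hX
    simpa [Set.inter_eq_self_of_subset_right hX] using leB X

lemma exists_amalgam {A B : Type u} [Finite A] [Finite B] {LA : LinearSpace A}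
    {LB : LinearSpace B} (hA : AntiPaschLS LA) (hB : AntiPaschLS LB) (C : Type u)
    (eA : C → A) (eB : C → B) (iA : Function.Injective eA) (iB : Function.Injective eB)
    (hC : ∀ x y z, x ≠ y → x ≠ z → y ≠ z →
      (Collin LA (eA x) (eA y) (eA z) ↔ Collin LB (eB x) (eB y) (eB z)))
    (sA : ∀ X, Set.range eA ⊆ X → LA.predim (Set.range eA) ≤ LA.predim X)
    (sB : ∀ X, Set.range eB ⊆ X → LB.predim (Set.range eB) ≤ LB.predim X) :
      ∃ (D : Type u) (LD : LinearSpace D) (f : A → D) (g : B → D),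
        Finite D ∧ AntiPaschLS LD ∧ IsLSEmbedding LA LD f ∧ IsLSEmbedding LB LD g ∧
        (∀ c : C, f (eA c) = g (eB c)) ∧
        StrongFin LD (Set.range f) ∧ StrongFin LD (Set.range g) := by
  induction hn : Nat.card A - Nat.card C using Nat.strong_induction_on generalizing C with
  | _ n ih =>
  have tA : LA.ThreePointLines := hA.1
  have tB : LB.ThreePointLines := hB.1
  by_cases hN : ∀ m₁ ∈ LA.lines, ∀ m₂ ∈ LB.lines, ∀ c₁ c₂, c₁ ≠ c₂ → eA c₁ ∈ m₁ → eA c₂ ∈ m₁ →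
      eB c₁ ∈ m₂ → eB c₂ ∈ m₂ → m₁ ⊆ Set.range eA ∨ m₂ ⊆ Set.range eB
  · exact exists_free_amalgam hA hB iA iB hC sA sB hN
  push Not at hN
  obtain ⟨m₁, hm₁, m₂, hm₂, c₁, c₂, hc, h₁₁, h₁₂, h₂₁, h₂₂, hr₁, hr₂⟩ := hN
  obtain ⟨a, ham, ha⟩ := Set.not_subset.1 hr₁
  obtain ⟨b, hbm, hb⟩ := Set.not_subset.1 hr₂
  have hne {X : Type u} {e : C → X} {p : X} (hp : p ∉ Set.range e) (c : C) : p ≠ e c :=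
    fun h => hp ⟨c, h.symm⟩
  have e₁ := tA.eq_triple hm₁ ham h₁₁ h₁₂ (hne ha _) (hne ha _) (iA.ne hc)
  have e₂ := tB.eq_triple hm₂ hbm h₂₁ h₂₂ (hne hb _) (hne hb _) (iB.ne hc)
  subst e₁ e₂
  have inj {X : Type u} {e : C → X} {p : X} (hp : p ∉ Set.range e) (i : Function.Injective e) :
      Function.Injective fun o : Option C => o.elim p e := by
    rintro (_ | x) (_ | y) h
    · rfl
    · exact absurd h (hne hp y)
    · exact absurd h.symm (hne hp x)
    · exact congrArg some (i h)
  have hab {x y : C} (hxy : x ≠ y) :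
      Collin LA a (eA x) (eA y) ↔ Collin LB b (eB x) (eB y) :=
    ⟨collin_transfer tA iA sA ha hm₁ hm₂ hxy, collin_transfer tB iB sB hb hm₂ hm₁ hxy⟩
  have iA' := inj ha iA
  have : Finite C := Finite.of_injective eA iA
  have hcard := Nat.card_le_card_of_injective _ iA'
  rw [Finite.card_option] at hcard
  have hC' : ∀ x y z : Option C, x ≠ y → x ≠ z → y ≠ z →
      (Collin LA (x.elim a eA) (y.elim a eA) (z.elim a eA) ↔
        Collin LB (x.elim b eB) (y.elim b eB) (z.elim b eB)) := by
    rintro (_ | x) (_ | y) (_ | z) hxy hxz hyz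
    all_goals try contradiction
    · exact hab fun h => hyz (congrArg some h)
    · exact collin_swap.trans ((hab fun h => hxz (congrArg some h)).trans collin_swap)
    · exact collin_rotate.trans ((hab fun h => hxy (congrArg some h)).trans collin_rotate.symm)
    · exact hC x y z (fun h => hxy (congrArg some h)) (fun h => hxz (congrArg some h))
        fun h => hyz (congrArg some h)
  obtain ⟨D, LD, f, g, hD, hP, hf, hg, hfg, hs⟩ := ih _ (by rw [← hn, Finite.card_option]; omega)
    (Option C) (fun o => o.elim a eA) (fun o => o.elim b eB) iA' (inj hb iB) hC'
    (predim_range_elim_le sA ha hm₁ ham (by simp [Set.insert_subset_iff]))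
    (predim_range_elim_le sB hb hm₂ hbm (by simp [Set.insert_subset_iff])) rfl
  exact ⟨D, LD, f, g, hD, hP, hf, hg, fun c => hfg (some c), hs⟩

end LinearSpace

/-- The class `K^P` of finite linear spaces with all lines of
exactly 3 points, `δ(S) ≥ 0` for all subsets, and no Pasch configuration has
the strong amalgamation property. -/
theorem antiPasch_amalgamation :
    AmalgProp (fun {M} LS => AntiPaschLS (M := M) LS) := by
  intro A B C LA LB LC _ _ _ hA hB _ eA eB hCA hCB sA sB
  exact LinearSpace.exists_amalgam hA hB C eA eB hCA.1 hCB.1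
    (fun x y z hxy hxz hyz => (hCA.2 x y z hxy hxz hyz).symm.trans (hCB.2 x y z hxy hxz hyz))
    ((LinearSpace.ThreePointLines.strongFin_iff hA.1).1 sA)
    ((LinearSpace.ThreePointLines.strongFin_iff hB.1).1 sB)
end

section
/- For every infinite cardinal κ there exists an ∞-sparse Steiner triple system (M,B) with |M| = κ. -/
/-- `B` is the family of blocks of a Steiner triple system on `M`: each block
has exactly 3 elements and each pair of distinct points lies in exactly one
block. -/
def IsSTS {M : Type*} (B : Set (Set M)) : Prop :=
  (∀ b ∈ B, b.ncard = 3) ∧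
  ∀ x y : M, x ≠ y → ∃! b : Set M, b ∈ B ∧ x ∈ b ∧ y ∈ b

/-- The predimension of a finite set `A`: `δ(A) = |A| − |{ℓ ∈ B : ℓ ⊆ A}|`. -/
noncomputable def stsDelta {M : Type*} (B : Set (Set M)) (A : Finset M) : ℤ :=
  (A.card : ℤ) - ({ℓ ∈ B | ℓ ⊆ (↑A : Set M)}).ncard

/-- A Steiner triple system is `∞`-sparse if no finite `A` with `|A| ≥ 6` has
`δ(A) = 2`. -/
def InftySparse {M : Type*} (B : Set (Set M)) : Prop :=
  ¬ ∃ A : Finset M, 6 ≤ A.card ∧ stsDelta B A = 2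

/-- A Pasch configuration: six distinct points `a,b,c,d,e,f` such that the
blocks contained in `{a,b,c,d,e,f}` are exactly
`{a,b,c}, {a,d,e}, {b,d,f}, {c,e,f}`. -/
def HasPasch {M : Type*} (B : Set (Set M)) : Prop :=
  ∃ a b c d e f : M, ([a, b, c, d, e, f] : List M).Pairwise (· ≠ ·) ∧
    {ℓ ∈ B | ℓ ⊆ ({a, b, c, d, e, f} : Set M)} =
      ({ {a, b, c}, {a, d, e}, {b, d, f}, {c, e, f} } : Set (Set M))

/-- A mitre configuration: seven distinct points `x,a,b,c,a',b',c'` such that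
the blocks contained in this set are exactly
`{a,b,c}, {a',b',c'}, {x,a,c'}, {x,b,b'}, {x,c,a'}`. -/
def HasMitre {M : Type*} (B : Set (Set M)) : Prop :=
  ∃ x a b c a' b' c' : M,
    ([x, a, b, c, a', b', c'] : List M).Pairwise (· ≠ ·) ∧
    {ℓ ∈ B | ℓ ⊆ ({x, a, b, c, a', b', c'} : Set M)} =
      ({ {a, b, c}, {a', b', c'}, {x, a, c'}, {x, b, b'}, {x, c, a'} } :
        Set (Set M))

/-- A mia configuration: seven distinct points `a,b,c,d,e,f,g` such that the
blocks contained in this set are exactly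
`{a,b,c}, {a,d,e}, {b,d,f}, {c,e,f}, {c,d,g}`. -/
def HasMia {M : Type*} (B : Set (Set M)) : Prop :=
  ∃ a b c d e f g : M,
    ([a, b, c, d, e, f, g] : List M).Pairwise (· ≠ ·) ∧
    {ℓ ∈ B | ℓ ⊆ ({a, b, c, d, e, f, g} : Set M)} =
      ({ {a, b, c}, {a, d, e}, {b, d, f}, {c, e, f}, {c, d, g} } : Set (Set M))

universe u

/-- If every block has a unique point of largest rank, and is determined by that point, then the
system is `∞`-sparse. -/
theorem inftySparse_of_rank {M : Type*} {B : Set (Set M)} (hB : IsSTS B) (h : M → ℕ)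
    (top : ∀ b ∈ B, ∃ p ∈ b, ∀ q ∈ b, q ≠ p → h q < h p)
    (inj : ∀ b ∈ B, ∀ c ∈ B, ∀ p, p ∈ b → p ∈ c → (∀ q ∈ b, q ≠ p → h q < h p) →
      (∀ q ∈ c, q ≠ p → h q < h p) → b = c) :
    InftySparse B := by
  classical
  have fin (A : Finset M) : {ℓ ∈ B | ℓ ⊆ (↑A : Set M)}.Finite :=
    A.finite_toSet.finite_subsets.subset fun ℓ hℓ => hℓ.2
  have key (n : ℕ) : ∀ A : Finset M, A.card = n + 4 →
      {ℓ ∈ B | ℓ ⊆ (↑A : Set M)}.ncard ≤ n + 1 := by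
    induction n with
    | zero =>
      intro A hA
      rw [Set.ncard_le_one (fin A)]
      rintro b ⟨hb, hbA⟩ c ⟨hc, hcA⟩
      lift b to Finset M using A.finite_toSet.subset hbA
      lift c to Finset M using A.finite_toSet.subset hcA
      have hb3 := hB.1 _ hb
      have hc3 := hB.1 _ hc
      rw [Set.ncard_coe_finset] at hb3 hc3
      have hu : (b ∪ c).card ≤ A.card :=
        Finset.card_le_card (Finset.union_subset (by exact_mod_cast hbA) (by exact_mod_cast hcA))
      have hi := Finset.card_union_add_card_inter b c
      obtain ⟨x, hx, y, hy, hxy⟩ := Finset.one_lt_card.1 (show 1 < (b ∩ c).card by omega)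
      rw [Finset.mem_inter] at hx hy
      exact (hB.2 x y hxy).unique ⟨hb, hx.1, hy.1⟩ ⟨hc, hx.2, hy.2⟩
    | succ n ih =>
      intro A hA
      obtain ⟨p, hp, hmax⟩ := A.exists_max_image h (Finset.card_pos.1 (by omega))
      have htop (b : Set M) (hb : b ∈ B) (hbA : b ⊆ A) (hpb : p ∈ b) :
          ∀ q ∈ b, q ≠ p → h q < h p := by
        obtain ⟨t, ht, hlt⟩ := top b hb
        by_cases hpt : p = t
        · exact hpt ▸ hlt
        · exact absurd (hmax t (hbA ht)) (hlt p hpb hpt).not_ge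
      have hsub : {ℓ ∈ B | ℓ ⊆ (↑A : Set M)} ⊆
          {ℓ ∈ B | ℓ ⊆ (↑(A.erase p) : Set M)} ∪ {ℓ ∈ B | ℓ ⊆ (↑A : Set M) ∧ p ∈ ℓ} := by
        rintro ℓ ⟨hℓ, hℓA⟩
        by_cases hpℓ : p ∈ ℓ
        · exact Or.inr ⟨hℓ, hℓA, hpℓ⟩
        · refine Or.inl ⟨hℓ, fun q hq => ?_⟩
          rw [Finset.mem_coe, Finset.mem_erase]
          exact ⟨fun e => hpℓ (e ▸ hq), hℓA hq⟩
      have fin' : {ℓ ∈ B | ℓ ⊆ (↑A : Set M) ∧ p ∈ ℓ}.Finite :=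
        (fin A).subset fun ℓ hℓ => ⟨hℓ.1, hℓ.2.1⟩
      have hone : {ℓ ∈ B | ℓ ⊆ (↑A : Set M) ∧ p ∈ ℓ}.ncard ≤ 1 := by
        rw [Set.ncard_le_one fin']
        rintro b ⟨hb, hbA, hpb⟩ c ⟨hc, hcA, hpc⟩
        exact inj b hb c hc p hpb hpc (htop b hb hbA hpb) (htop c hc hcA hpc)
      have h1 := ih (A.erase p) (by rw [Finset.card_erase_of_mem hp]; omega)
      have h2 := Set.ncard_le_ncard hsub ((fin _).union fin')
      have h3 := Set.ncard_union_le {ℓ ∈ B | ℓ ⊆ (↑(A.erase p) : Set M)}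
        {ℓ ∈ B | ℓ ⊆ (↑A : Set M) ∧ p ∈ ℓ}
      omega
  rintro ⟨A, hA, hδ⟩
  have := key (A.card - 4) A (by omega)
  unfold stsDelta at hδ
  omega

/-- A relation `T a b c`, read as "`c` is freely generated by the pair `a, b`", yields an
`∞`-sparse Steiner triple system with blocks `{a, b, c}`. -/
theorem isSTS_and_inftySparse_of_rel {M : Type*} (T : M → M → M → Prop) (h : M → ℕ)
    (lt_left : ∀ {a b c}, T a b c → h a < h c) (lt_right : ∀ {a b c}, T a b c → h b < h c)
    (asymm : ∀ {a b c c'}, T a b c → ¬ T b a c')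
    (func : ∀ {a b c c'}, T a b c → T a b c' → c = c')
    (inj : ∀ {a b a' b' c}, T a b c → T a' b' c → a = a' ∧ b = b')
    (free : ∀ {a b c d}, T a b c → ¬ T a d b ∧ ¬ T d a b ∧ ¬ T b d a ∧ ¬ T d b a)
    (ex : ∀ {a b}, a ≠ b →
      ∃ c, T a b c ∨ T b a c ∨ T a c b ∨ T c a b ∨ T b c a ∨ T c b a) :
    IsSTS {s | ∃ a b c, T a b c ∧ s = ({a, b, c} : Set M)} ∧
      InftySparse {s | ∃ a b c, T a b c ∧ s = ({a, b, c} : Set M)} := by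
  have hne {a b c} (t : T a b c) : a ≠ b ∧ a ≠ c ∧ b ≠ c :=
    ⟨fun e => by subst e; exact asymm t t, fun e => (lt_left t).ne (congrArg h e),
      fun e => (lt_right t).ne (congrArg h e)⟩
  have hsts : IsSTS {s | ∃ a b c, T a b c ∧ s = ({a, b, c} : Set M)} := by
    refine ⟨?_, fun x y hxy => ?_⟩
    · rintro _ ⟨a, b, c, t, rfl⟩
      exact Set.ncard_eq_three.2 ⟨a, b, c, (hne t).1, (hne t).2.1, (hne t).2.2, rfl⟩
    · apply existsUnique_of_exists_of_unique
      · obtain ⟨c, t | t | t | t | t | t⟩ := ex hxy <;>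
          exact ⟨_, ⟨_, _, _, t, rfl⟩, by simp, by simp⟩
      · rintro _ _ ⟨⟨a, b, c, t, rfl⟩, hx, hy⟩ ⟨⟨a', b', c', t', rfl⟩, hx', hy'⟩
        simp only [Set.mem_insert_iff, Set.mem_singleton_iff] at hx hy hx' hy'
        have h1 := lt_left t
        have h2 := lt_right t
        have h1' := lt_left t'
        have h2' := lt_right t'
        have hf := @free _ _ _ a' t
        have hg := @free _ _ _ b' t
        have hf' := @free _ _ _ a t'
        have hg' := @free _ _ _ b t'
        have has := @asymm _ _ _ c' t
        suffices a = a' ∧ b = b' ∧ c = c' by obtain ⟨rfl, rfl, rfl⟩ := this; rfl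
        have hfu := @func _ _ _ c' t
        have hin := @inj _ _ a' b' _ t
        grind
  refine ⟨hsts, inftySparse_of_rank hsts h ?_ ?_⟩
  · rintro _ ⟨a, b, c, t, rfl⟩
    refine ⟨c, by simp, ?_⟩
    rintro q (rfl | rfl | rfl) hq
    exacts [lt_left t, lt_right t, absurd rfl hq]
  · have top_eq {a b c p} (t : T a b c) (hp : p ∈ ({a, b, c} : Set M))
        (hlt : ∀ q ∈ ({a, b, c} : Set M), q ≠ p → h q < h p) : c = p := by
      by_contra hcp
      have := hlt c (by simp) hcp
      have h1 := lt_left t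
      have h2 := lt_right t
      rcases hp with rfl | rfl | rfl <;> omega
    rintro _ ⟨a, b, c, t, rfl⟩ _ ⟨a', b', c', t', rfl⟩ p hp hp' hlt hlt'
    obtain rfl := top_eq t hp hlt
    obtain rfl := top_eq t' hp' hlt'
    obtain ⟨rfl, rfl⟩ := inj t t'
    rfl

/-- One of the two terms is a product having the other one as a factor. -/
def FreeMagma.Linked {α : Type*} (x y : FreeMagma α) : Prop :=
  ∃ z, x * z = y ∨ z * x = y ∨ y * z = x ∨ z * y = x

/-- The terms all of whose products have increasing, unlinked factors: normal forms for the
elements of the free Steiner quasigroup on `α`. -/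
def FreeMagma.IsNormal {α : Type*} (r : FreeMagma α → FreeMagma α → Prop) : FreeMagma α → Prop
  | .of _ => True
  | .mul x y => IsNormal r x ∧ IsNormal r y ∧ r x y ∧ ¬ Linked x y

theorem FreeMagma.isNormal_mul {α : Type*} {r : FreeMagma α → FreeMagma α → Prop}
    {x y : FreeMagma α} :
    IsNormal r (x * y) ↔ IsNormal r x ∧ IsNormal r y ∧ r x y ∧ ¬ Linked x y :=
  Iff.rfl

theorem FreeMagma.mul_inj {α : Type*} {x y x' y' : FreeMagma α} :
    x * y = x' * y' ↔ x = x' ∧ y = y' :=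
  ⟨fun e => by cases e; exact ⟨rfl, rfl⟩, fun e => by rw [e.1, e.2]⟩

theorem FreeMagma.of_injective {α : Type*} : Function.Injective (FreeMagma.of (α := α)) :=
  fun _ _ e => by cases e; rfl

theorem FreeMagma.mk_eq {α : Type u} [Infinite α] : Cardinal.mk (FreeMagma α) = Cardinal.mk α := by
  apply le_antisymm
  · have hle : Cardinal.mk (α ⊕ α × α) ≤ Cardinal.mk α := by
      have := Cardinal.aleph0_le_mk α
      simp [Cardinal.mul_eq_self this, Cardinal.add_eq_self this]
    obtain ⟨f⟩ := Cardinal.le_def _ _ |>.1 hle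
    let g : FreeMagma α → α := fun t =>
      FreeMagma.rec (fun a => f (.inl a)) (fun _ _ a b => f (.inr (a, b))) t
    have hg : Function.Injective g := by
      intro s
      induction s with
      | ih1 a =>
        rintro (b | ⟨x, y⟩) e
        · exact congrArg _ (Sum.inl.inj (f.injective e))
        · exact absurd (f.injective e) (by simp)
      | ih2 x y hx hy =>
        rintro (b | ⟨x', y'⟩) e
        · exact absurd (f.injective e) (by simp)
        · have e' := Prod.ext_iff.1 (Sum.inr.inj (f.injective e))
          exact FreeMagma.mul_inj.2 ⟨hx e'.1, hy e'.2⟩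
    exact Cardinal.mk_le_of_injective hg
  · exact Cardinal.mk_le_of_injective FreeMagma.of_injective

/-- For every infinite cardinal `κ` there exists an `∞`-sparse
Steiner triple system of cardinality `κ`. -/
theorem exists_sparse_STS (κ : Cardinal.{u}) (hκ : Cardinal.aleph0 ≤ κ) :
    ∃ (M : Type u) (B : Set (Set M)),
      Cardinal.mk M = κ ∧ IsSTS B ∧ InftySparse B := by
  induction κ using Cardinal.inductionOn with | mk α => ?_
  have : Infinite α := Cardinal.infinite_iff.2 hκ
  let r : FreeMagma α → FreeMagma α → Prop := WellOrderingRel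
  let M := {t : FreeMagma α // t.IsNormal r}
  have prop {a b : M} {t : FreeMagma α} (e : a.1 * b.1 = t) (ht : t.IsNormal r) :
      r a.1 b.1 ∧ ¬ FreeMagma.Linked a.1 b.1 := (FreeMagma.isNormal_mul.1 (e ▸ ht)).2.2
  refine ⟨M, _, ?_, isSTS_and_inftySparse_of_rel (M := M) (fun a b c => a.1 * b.1 = c.1)
    (fun a => a.1.length) ?_ ?_ ?_ ?_ ?_ ?_ ?_⟩
  · refine le_antisymm ((Cardinal.mk_subtype_le _).trans FreeMagma.mk_eq.le) ?_
    exact Cardinal.mk_le_of_injective (f := fun a => (⟨.of a, trivial⟩ : M))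
      fun _ _ e => FreeMagma.of_injective (congrArg Subtype.val e)
  · intro a b c e
    have := b.1.length_pos
    have := congrArg FreeMagma.length e
    change a.1.length + b.1.length = _ at this
    omega
  · intro a b c e
    have := a.1.length_pos
    have := congrArg FreeMagma.length e
    change a.1.length + b.1.length = _ at this
    omega
  · intro a b c c' e e'
    exact _root_.asymm (prop e c.2).1 (prop e' c'.2).1
  · intro a b c c' e e'
    exact Subtype.ext (e.symm.trans e')
  · intro a b a' b' c e e'
    exact (FreeMagma.mul_inj.1 (e.trans e'.symm)).imp Subtype.ext Subtype.ext
  · intro a b c d e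
    have := (prop e c.2).2
    simp only [FreeMagma.Linked, not_exists, not_or] at this
    exact this d.1
  · intro a b hab
    by_cases hl : FreeMagma.Linked a.1 b.1
    · have factors {x y : FreeMagma α} {t : M} (e : x * y = t.1) :
          x.IsNormal r ∧ y.IsNormal r :=
        (FreeMagma.isNormal_mul.1 (e ▸ t.2)).imp_right And.left
      obtain ⟨z, e | e | e | e⟩ := hl
      · exact ⟨⟨z, (factors e).2⟩, by simp [e]⟩
      · exact ⟨⟨z, (factors e).1⟩, by simp [e]⟩
      · exact ⟨⟨z, (factors e).2⟩, by simp [e]⟩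
      · exact ⟨⟨z, (factors e).1⟩, by simp [e]⟩
    · rcases trichotomous_of r a.1 b.1 with hr | hr | hr
      · exact ⟨⟨a.1 * b.1, FreeMagma.isNormal_mul.2 ⟨a.2, b.2, hr, hl⟩⟩, Or.inl rfl⟩
      · exact absurd (Subtype.ext hr) hab
      · refine ⟨⟨b.1 * a.1, FreeMagma.isNormal_mul.2 ⟨b.2, a.2, hr, ?_⟩⟩, Or.inr (Or.inl rfl)⟩
        rintro ⟨z, hz⟩
        exact hl ⟨z, by tauto⟩
end

section
/- There exist continuum many pairwise non-isomorphic countable ∞-sparse Steiner triple systems: there is a function assigning to each set s ⊆ ℕ a family B_s of 3-element subsets of ℕ such that each (ℕ, B_s) is an ∞-sparse Steiner triple system and, for s ≠ t, no bijection of ℕ carries B_s onto B_t. -/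
namespace SteinerTriple

open Finset

/-- Two distinct points lie in at most one block. -/
def IsLinear (B : Set (Finset ℕ)) : Prop :=
  ∀ b ∈ B, ∀ c ∈ B, ∀ x y, x ≠ y → x ∈ b → y ∈ b → x ∈ c → y ∈ c → b = c

/-- The blocks of `B` contained in `A`. -/
noncomputable def blocksIn (B : Set (Finset ℕ)) (A : Finset ℕ) : Finset (Finset ℕ) :=
  open Classical in A.powerset.filter (· ∈ B)

lemma mem_blocksIn {B : Set (Finset ℕ)} {A b : Finset ℕ} :
    b ∈ blocksIn B A ↔ b ⊆ A ∧ b ∈ B := by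
  simp [blocksIn]

/-- Every set of at least four points has predimension at least three. -/
def IsSparse (B : Set (Finset ℕ)) : Prop :=
  ∀ A : Finset ℕ, 4 ≤ #A → #(blocksIn B A) + 3 ≤ #A

/-- Every point of `S` lies on two blocks contained in `S`. -/
def Confined (B : Set (Finset ℕ)) (S : Finset ℕ) : Prop :=
  ∀ x ∈ S, ∃ b ∈ B, ∃ c ∈ B, b ≠ c ∧ x ∈ b ∧ x ∈ c ∧ b ⊆ S ∧ c ⊆ S

/-- A nonempty confined set without proper nonempty confined subsets. -/
def MinimalConfined (B : Set (Finset ℕ)) (S : Finset ℕ) : Prop :=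
  S.Nonempty ∧ Confined B S ∧ ∀ T ⊆ S, T.Nonempty → Confined B T → T = S

lemma Confined.map {B B' : Set (Finset ℕ)} (e : ℕ ≃ ℕ)
    (h : ∀ b ∈ B, b.map e.toEmbedding ∈ B') {S : Finset ℕ} (hS : Confined B S) :
    Confined B' (S.map e.toEmbedding) := by
  intro y hy
  obtain ⟨x, hx, rfl⟩ := mem_map.1 hy
  obtain ⟨b, hb, c, hc, hne, hxb, hxc, hbS, hcS⟩ := hS x hx
  exact ⟨_, h b hb, _, h c hc, fun h' => hne (map_injective _ h'), mem_map_of_mem _ hxb,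
    mem_map_of_mem _ hxc, map_subset_map.2 hbS, map_subset_map.2 hcS⟩

lemma MinimalConfined.map {B B' : Set (Finset ℕ)} (e : ℕ ≃ ℕ)
    (h : ∀ b, b ∈ B ↔ b.map e.toEmbedding ∈ B') {S : Finset ℕ} (hS : MinimalConfined B S) :
    MinimalConfined B' (S.map e.toEmbedding) := by
  obtain ⟨hne, hconf, hmin⟩ := hS
  refine ⟨hne.map, hconf.map e fun b hb => (h b).1 hb, fun T hTS hT hTc => ?_⟩
  have hback : ∀ U : Finset ℕ, (U.map e.symm.toEmbedding).map e.toEmbedding = U := by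
    intro U; ext x; simp
  have key := hmin (T.map e.symm.toEmbedding)
    (by rwa [← map_subset_map (f := e.toEmbedding), hback]) hT.map
    (hTc.map e.symm fun b hb => by rwa [h, hback])
  rw [← key, hback]

/-! ### Free completion -/

/-- The stages of the free completion: at stage `k` the pair of points coded by `k`, unless
already collinear, is completed to a block by the new point `2 * k + 1`. -/
def stage (B : Set (Finset ℕ)) : ℕ → Set (Finset ℕ)
  | 0 => B
  | k + 1 => stage B k ∪ {b | b = {k.unpair.1, k.unpair.2, 2 * k + 1} ∧
      k.unpair.1 ≠ k.unpair.2 ∧ ∀ c ∈ stage B k, ¬(k.unpair.1 ∈ c ∧ k.unpair.2 ∈ c)}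

/-- The free completion of a partial triple system living on the even numbers. -/
def completion (B : Set (Finset ℕ)) : Set (Finset ℕ) := ⋃ k, stage B k

section Completion

variable {B : Set (Finset ℕ)}

lemma stage_mono : Monotone (stage B) :=
  monotone_nat_of_le_succ fun _ _ h => Or.inl h

lemma mem_stage {k : ℕ} {b : Finset ℕ} (hb : b ∈ stage B k) :
    b ∈ B ∨ ∃ j < k, j.unpair.1 ≠ j.unpair.2 ∧ b = {j.unpair.1, j.unpair.2, 2 * j + 1} := by
  induction k with
  | zero => exact Or.inl hb
  | succ k ih =>
    rcases hb with hb | ⟨rfl, hne, -⟩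
    · rcases ih hb with h | ⟨j, hj, h⟩
      · exact Or.inl h
      · exact Or.inr ⟨j, by omega, h⟩
    · exact Or.inr ⟨k, by omega, hne, rfl⟩

lemma lt_of_odd_mem_stage (heven : ∀ b ∈ B, ∀ x ∈ b, Even x) {k j : ℕ} {b : Finset ℕ}
    (hb : b ∈ stage B k) (hj : 2 * j + 1 ∈ b) : j < k := by
  rcases mem_stage hb with hb | ⟨i, hi, -, rfl⟩
  · have := heven b hb _ hj
    rw [Nat.even_iff] at this
    omega
  · have h1 := Nat.unpair_left_le i
    have h2 := Nat.unpair_right_le i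
    simp only [mem_insert, mem_singleton] at hj
    omega

lemma card_of_mem_completion (hcard : ∀ b ∈ B, #b = 3) {b : Finset ℕ}
    (hb : b ∈ completion B) : #b = 3 := by
  obtain ⟨k, hb⟩ := Set.mem_iUnion.1 hb
  rcases mem_stage hb with hb | ⟨i, -, hne, rfl⟩
  · exact hcard b hb
  · have h1 := Nat.unpair_left_le i
    have h2 := Nat.unpair_right_le i
    exact card_eq_three.2 ⟨_, _, _, hne, by omega, by omega, rfl⟩

lemma isLinear_stage (heven : ∀ b ∈ B, ∀ x ∈ b, Even x) (hlin : IsLinear B) (k : ℕ) :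
    IsLinear (stage B k) := by
  induction k with
  | zero => exact hlin
  | succ k ih =>
    have aux : ∀ c ∈ stage B k, (∀ c ∈ stage B k, ¬(k.unpair.1 ∈ c ∧ k.unpair.2 ∈ c)) →
        ∀ x y, x ≠ y → x ∈ c → y ∈ c →
        x ∈ ({k.unpair.1, k.unpair.2, 2 * k + 1} : Finset ℕ) →
        y ∈ ({k.unpair.1, k.unpair.2, 2 * k + 1} : Finset ℕ) → False := by
      intro c hc hno x y hxy hx hy hx' hy'
      have hfresh : 2 * k + 1 ∉ c := fun h => (lt_of_odd_mem_stage heven hc h).false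
      have := hno c hc
      simp only [mem_insert, mem_singleton] at hx' hy'
      grind
    rintro b (hb | ⟨rfl, -, hno⟩) c (hc | ⟨rfl, -, hno'⟩) x y hxy hxb hyb hxc hyc
    · exact ih b hb c hc x y hxy hxb hyb hxc hyc
    · exact (aux b hb hno' x y hxy hxb hyb hxc hyc).elim
    · exact (aux c hc hno x y hxy hxc hyc hxb hyb).elim
    · rfl

lemma isLinear_completion (heven : ∀ b ∈ B, ∀ x ∈ b, Even x) (hlin : IsLinear B) :
    IsLinear (completion B) := by
  intro b hb c hc
  obtain ⟨k, hb⟩ := Set.mem_iUnion.1 hb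
  obtain ⟨l, hc⟩ := Set.mem_iUnion.1 hc
  exact isLinear_stage heven hlin (max k l) b (stage_mono (le_max_left k l) hb) c
    (stage_mono (le_max_right k l) hc)

lemma exists_mem_completion {x y : ℕ} (hxy : x ≠ y) :
    ∃ b ∈ completion B, x ∈ b ∧ y ∈ b := by
  by_cases h : ∃ b ∈ stage B (Nat.pair x y), x ∈ b ∧ y ∈ b
  · obtain ⟨b, hb, h⟩ := h
    exact ⟨b, Set.mem_iUnion.2 ⟨_, hb⟩, h⟩
  · refine ⟨{x, y, 2 * Nat.pair x y + 1},
      Set.mem_iUnion.2 ⟨Nat.pair x y + 1, Or.inr ⟨by simp, by simpa, ?_⟩⟩, by simp, by simp⟩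
    simpa using h

lemma isSparse_stage (heven : ∀ b ∈ B, ∀ x ∈ b, Even x) (hcard : ∀ b ∈ B, #b = 3)
    (hsp : IsSparse B) (k : ℕ) : IsSparse (stage B k) := by
  induction k with
  | zero => exact hsp
  | succ k ih =>
    intro A hA
    set n : Finset ℕ := {k.unpair.1, k.unpair.2, 2 * k + 1} with hn
    by_cases hnew : n ∈ stage B (k + 1) ∧ n ∉ stage B k ∧ n ⊆ A
    · obtain ⟨h1, h2, hnA⟩ := hnew
      obtain ⟨-, hne, hno⟩ := h1.resolve_left h2
      have hz : 2 * k + 1 ∈ A := hnA (by simp [hn])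
      have hx : k.unpair.1 ∈ A.erase (2 * k + 1) := by
        have := Nat.unpair_left_le k
        exact mem_erase.2 ⟨by omega, hnA (by simp [hn])⟩
      have hy : k.unpair.2 ∈ A.erase (2 * k + 1) := by
        have := Nat.unpair_right_le k
        exact mem_erase.2 ⟨by omega, hnA (by simp [hn])⟩
      have hsub : blocksIn (stage B (k + 1)) A ⊆
          insert n (blocksIn (stage B k) (A.erase (2 * k + 1))) := by
        intro b hb
        obtain ⟨hbA, hb | ⟨rfl, -⟩⟩ := mem_blocksIn.1 hb
        · refine mem_insert_of_mem (mem_blocksIn.2 ⟨fun x hx => mem_erase.2 ⟨?_, hbA hx⟩, hb⟩)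
          rintro rfl
          exact (lt_of_odd_mem_stage heven hb hx).false
        · exact mem_insert_self _ _
      have hle := (card_le_card hsub).trans (card_insert_le _ _)
      have hce := card_erase_add_one hz
      by_cases hA5 : 4 ≤ #(A.erase (2 * k + 1))
      · have := ih _ hA5
        omega
      · have hempty : blocksIn (stage B k) (A.erase (2 * k + 1)) = ∅ := by
          refine eq_empty_of_forall_notMem fun b hb => ?_
          obtain ⟨hbA, hb⟩ := mem_blocksIn.1 hb
          have hb3 := card_of_mem_completion hcard (Set.mem_iUnion.2 ⟨k, hb⟩)
          have heq := eq_of_subset_of_card_le hbA (by omega)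
          exact hno b hb ⟨heq ▸ hx, heq ▸ hy⟩
        rw [hempty, card_empty] at hle
        omega
    · refine (Nat.add_le_add_right (card_le_card fun b hb => ?_) 3).trans (ih A hA)
      obtain ⟨hbA, hb⟩ := mem_blocksIn.1 hb
      refine mem_blocksIn.2 ⟨hbA, ?_⟩
      by_contra hb'
      have hbn : b = n := (hb.resolve_left hb').1
      subst hbn
      exact hnew ⟨hb, hb', hbA⟩

lemma isSparse_completion (heven : ∀ b ∈ B, ∀ x ∈ b, Even x) (hcard : ∀ b ∈ B, #b = 3)
    (hsp : IsSparse B) : IsSparse (completion B) := by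
  intro A hA
  refine (Nat.add_le_add_right (card_le_card fun b hb => ?_) 3).trans
    (isSparse_stage heven hcard hsp (A.sup id) A hA)
  obtain ⟨hbA, hb⟩ := mem_blocksIn.1 hb
  refine mem_blocksIn.2 ⟨hbA, ?_⟩
  obtain ⟨k, hk⟩ := Set.mem_iUnion.1 hb
  induction k with
  | zero => exact stage_mono (Nat.zero_le _) hk
  | succ k ih =>
    rcases hk with hl | hl
    · exact ih hl
    · have : 2 * k + 1 ≤ A.sup id := le_sup (f := id) (hbA (by simp [hl.1]))
      exact stage_mono (show k + 1 ≤ A.sup id by omega) (Or.inr hl)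

/-- Finite confined sets of the free completion already live in the initial system. -/
lemma confined_of_confined_completion {S : Finset ℕ} (heven : ∀ b ∈ B, ∀ x ∈ b, Even x)
    (hS : Confined (completion B) S) : Confined B S := by
  have hodd : ∀ j, 2 * j + 1 ∉ S := by
    by_contra! hex
    obtain ⟨j₀, hj₀⟩ := hex
    obtain ⟨m, hm, hmax⟩ := (S.filter Odd).exists_max_image id
      ⟨2 * j₀ + 1, mem_filter.2 ⟨hj₀, by simp⟩⟩
    obtain ⟨hmS, j, rfl⟩ := mem_filter.1 hm
    have hblock : ∀ b ∈ completion B, 2 * j + 1 ∈ b → b ⊆ S →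
        b = {j.unpair.1, j.unpair.2, 2 * j + 1} := by
      intro b hb hjb hbS
      obtain ⟨k, hb⟩ := Set.mem_iUnion.1 hb
      rcases mem_stage hb with hb | ⟨i, -, -, rfl⟩
      · exact absurd (heven b hb _ hjb) (by simp)
      · have h1 := Nat.unpair_left_le i
        have h2 := Nat.unpair_right_le i
        have h3 := hmax (2 * i + 1) (mem_filter.2 ⟨hbS (by simp), by simp⟩)
        simp only [id] at h3
        simp only [mem_insert, mem_singleton] at hjb
        obtain rfl : i = j := by omega
        rfl
    obtain ⟨b, hb, c, hc, hne, hxb, hxc, hbS, hcS⟩ := hS _ hmS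
    exact hne ((hblock b hb hxb hbS).trans (hblock c hc hxc hcS).symm)
  have hbase : ∀ b ∈ completion B, b ⊆ S → b ∈ B := by
    intro b hb hbS
    obtain ⟨k, hb⟩ := Set.mem_iUnion.1 hb
    rcases mem_stage hb with hb | ⟨i, -, -, rfl⟩
    · exact hb
    · exact absurd (hbS (by simp)) (hodd i)
  intro x hx
  obtain ⟨b, hb, c, hc, hne, hxb, hxc, hbS, hcS⟩ := hS x hx
  exact ⟨b, hbase b hb hbS, c, hbase c hc hcS, hne, hxb, hxc, hbS, hcS⟩

end Completion

/-! ### Cyclic grids -/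

/-- The point in row `a` and column `b` of the `n`-th grid. -/
def pt (n : ℕ) (a b : ZMod (n + 3)) : ℕ := 2 * Nat.pair n (Nat.pair a.val b.val)

lemma even_pt (n : ℕ) (a b : ZMod (n + 3)) : Even (pt n a b) := by simp [pt]

lemma pt_inj {n : ℕ} {a b a' b' : ZMod (n + 3)} : pt n a b = pt n a' b' ↔ a = a' ∧ b = b' := by
  simp [pt, Nat.pair_eq_pair, (ZMod.val_injective (n + 3)).eq_iff]

lemma index_eq_of_pt_eq {n m : ℕ} {a b : ZMod (n + 3)} {a' b' : ZMod (m + 3)}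
    (h : pt n a b = pt m a' b') : n = m := by
  simp only [pt, mul_eq_mul_left_iff, Nat.pair_eq_pair] at h
  omega

/-- The three points of a row. -/
def row (n : ℕ) (a : ZMod (n + 3)) : Finset ℕ := {pt n a a, pt n a (a + 1), pt n a (a + 2)}

/-- The three points of a column. -/
def col (n : ℕ) (b : ZMod (n + 3)) : Finset ℕ := {pt n b b, pt n (b - 1) b, pt n (b - 2) b}

lemma exists_of_mem_row {n x : ℕ} {a : ZMod (n + 3)} (h : x ∈ row n a) : ∃ b, x = pt n a b := by
  simp only [row, mem_insert, mem_singleton] at h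
  rcases h with h | h | h <;> exact ⟨_, h⟩

lemma exists_of_mem_col {n x : ℕ} {b : ZMod (n + 3)} (h : x ∈ col n b) : ∃ a, x = pt n a b := by
  simp only [col, mem_insert, mem_singleton] at h
  rcases h with h | h | h <;> exact ⟨_, h⟩

lemma zmod_one_ne_zero (n : ℕ) : (1 : ZMod (n + 3)) ≠ 0 := by
  have : Fact (1 < n + 3) := ⟨by omega⟩
  exact one_ne_zero

lemma zmod_two_ne_zero (n : ℕ) : (2 : ZMod (n + 3)) ≠ 0 := by
  intro h
  have h2 : ((2 : ℕ) : ZMod (n + 3)) = 0 := by exact_mod_cast h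
  have := Nat.le_of_dvd (by omega) ((ZMod.natCast_eq_zero_iff _ _).1 h2)
  omega

lemma zmod_one_ne_two (n : ℕ) : (1 : ZMod (n + 3)) ≠ 2 := by
  intro h
  apply zmod_one_ne_zero n
  linear_combination -h

lemma card_row (n : ℕ) (a : ZMod (n + 3)) : #(row n a) = 3 :=
  card_eq_three.2 ⟨_, _, _, by simp [pt_inj, zmod_one_ne_zero],
    by simp [pt_inj, zmod_two_ne_zero], by simp [pt_inj, zmod_one_ne_two], rfl⟩

lemma card_col (n : ℕ) (b : ZMod (n + 3)) : #(col n b) = 3 :=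
  card_eq_three.2 ⟨_, _, _, by simp [pt_inj, eq_comm (a := b), zmod_one_ne_zero],
    by simp [pt_inj, eq_comm (a := b), zmod_two_ne_zero],
    by simp [pt_inj, zmod_one_ne_two], rfl⟩

/-- The rows of the grids with index in `s`. -/
def rows (s : Set ℕ) : Set (Finset ℕ) := {b | ∃ n ∈ s, ∃ a, b = row n a}

/-- The columns of the grids with index in `s`. -/
def cols (s : Set ℕ) : Set (Finset ℕ) := {b | ∃ n ∈ s, ∃ a, b = col n a}

/-- The disjoint union of the grids with index in `s`. -/
def grids (s : Set ℕ) : Set (Finset ℕ) := rows s ∪ cols s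

section Grids

variable {s : Set ℕ}

lemma rows_eq_of_mem {b c : Finset ℕ} (hb : b ∈ rows s) (hc : c ∈ rows s) {x : ℕ}
    (hxb : x ∈ b) (hxc : x ∈ c) : b = c := by
  obtain ⟨n, -, a, rfl⟩ := hb
  obtain ⟨m, -, a', rfl⟩ := hc
  obtain ⟨d, rfl⟩ := exists_of_mem_row hxb
  obtain ⟨d', h⟩ := exists_of_mem_row hxc
  obtain rfl := index_eq_of_pt_eq h
  rw [(pt_inj.1 h).1]

lemma cols_eq_of_mem {b c : Finset ℕ} (hb : b ∈ cols s) (hc : c ∈ cols s) {x : ℕ}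
    (hxb : x ∈ b) (hxc : x ∈ c) : b = c := by
  obtain ⟨n, -, a, rfl⟩ := hb
  obtain ⟨m, -, a', rfl⟩ := hc
  obtain ⟨d, rfl⟩ := exists_of_mem_col hxb
  obtain ⟨d', h⟩ := exists_of_mem_col hxc
  obtain rfl := index_eq_of_pt_eq h
  rw [(pt_inj.1 h).2]

lemma eq_of_mem_row_col {b c : Finset ℕ} (hb : b ∈ rows s) (hc : c ∈ cols s) {x y : ℕ}
    (hxb : x ∈ b) (hyb : y ∈ b) (hxc : x ∈ c) (hyc : y ∈ c) : x = y := by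
  obtain ⟨n, -, a, rfl⟩ := hb
  obtain ⟨m, -, a', rfl⟩ := hc
  obtain ⟨d, rfl⟩ := exists_of_mem_row hxb
  obtain ⟨d', rfl⟩ := exists_of_mem_row hyb
  obtain ⟨f, h⟩ := exists_of_mem_col hxc
  obtain ⟨f', h'⟩ := exists_of_mem_col hyc
  obtain rfl := index_eq_of_pt_eq h
  rw [(pt_inj.1 h).2, (pt_inj.1 h').2]

lemma card_inter_row_col_le {b c : Finset ℕ} (hb : b ∈ rows s) (hc : c ∈ cols s) :
    #(b ∩ c) ≤ 1 :=
  card_le_one.2 fun _ hx _ hy => eq_of_mem_row_col hb hc (mem_inter.1 hx).1 (mem_inter.1 hy).1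
    (mem_inter.1 hx).2 (mem_inter.1 hy).2

lemma card_of_mem_rows {b : Finset ℕ} (hb : b ∈ rows s) : #b = 3 := by
  obtain ⟨n, -, a, rfl⟩ := hb
  exact card_row n a

lemma card_of_mem_cols {b : Finset ℕ} (hb : b ∈ cols s) : #b = 3 := by
  obtain ⟨n, -, a, rfl⟩ := hb
  exact card_col n a

lemma card_of_mem_grids {b : Finset ℕ} (hb : b ∈ grids s) : #b = 3 :=
  hb.elim card_of_mem_rows card_of_mem_cols

lemma even_of_mem_grids : ∀ b ∈ grids s, ∀ x ∈ b, Even x := by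
  rintro _ (⟨n, -, a, rfl⟩ | ⟨n, -, a, rfl⟩) x hx
  · obtain ⟨d, rfl⟩ := exists_of_mem_row hx
    exact even_pt _ _ _
  · obtain ⟨d, rfl⟩ := exists_of_mem_col hx
    exact even_pt _ _ _

lemma isLinear_grids : IsLinear (grids s) := by
  rintro b (hb | hb) c (hc | hc) x y hxy hxb hyb hxc hyc
  · exact rows_eq_of_mem hb hc hxb hxc
  · exact (hxy (eq_of_mem_row_col hb hc hxb hyb hxc hyc)).elim
  · exact (hxy (eq_of_mem_row_col hc hb hxc hyc hxb hyb)).elim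
  · exact cols_eq_of_mem hb hc hxb hxc

/-- Disjoint blocks that keep `m` points each outside `K` occupy many points outside `K`. -/
lemma mul_card_add_card_le {L : Finset (Finset ℕ)} {A K : Finset ℕ} {m : ℕ}
    (hdisj : ∀ b ∈ L, ∀ c ∈ L, ∀ x ∈ b, x ∈ c → b = c) (hA : ∀ b ∈ L, b ⊆ A) (hK : K ⊆ A)
    (hm : ∀ b ∈ L, m ≤ #(b \ K)) : #L * m + #K ≤ #A := by
  have h1 : #(L.biUnion (· \ K)) = ∑ b ∈ L, #(b \ K) :=
    card_biUnion fun b hb c hc hne => disjoint_left.2 fun x hx hx' =>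
      hne (hdisj b hb c hc x (mem_sdiff.1 hx).1 (mem_sdiff.1 hx').1)
  have h2 : #L * m ≤ ∑ b ∈ L, #(b \ K) := by
    simpa using card_nsmul_le_sum L (fun b => #(b \ K)) m hm
  have h3 : L.biUnion (· \ K) ⊆ A \ K :=
    biUnion_subset.2 fun b hb => sdiff_subset_sdiff (hA b hb) le_rfl
  have h4 := card_le_card h3
  have h5 := card_sdiff_add_card_eq_card hK
  omega

lemma isSparse_grids : IsSparse (grids s) := by
  intro A hA
  have hsub : blocksIn (grids s) A ⊆ blocksIn (rows s) A ∪ blocksIn (cols s) A := by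
    intro b hb
    obtain ⟨hbA, hb | hb⟩ := mem_blocksIn.1 hb
    · exact mem_union_left _ (mem_blocksIn.2 ⟨hbA, hb⟩)
    · exact mem_union_right _ (mem_blocksIn.2 ⟨hbA, hb⟩)
  have hle := (card_le_card hsub).trans (card_union_le _ _)
  have hrd : ∀ b ∈ blocksIn (rows s) A, ∀ c ∈ blocksIn (rows s) A, ∀ x ∈ b, x ∈ c → b = c :=
    fun b hb c hc x hx hx' => rows_eq_of_mem (mem_blocksIn.1 hb).2 (mem_blocksIn.1 hc).2 hx hx'
  have hcd : ∀ b ∈ blocksIn (cols s) A, ∀ c ∈ blocksIn (cols s) A, ∀ x ∈ b, x ∈ c → b = c :=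
    fun b hb c hc x hx hx' => cols_eq_of_mem (mem_blocksIn.1 hb).2 (mem_blocksIn.1 hc).2 hx hx'
  have hr3 := mul_card_add_card_le (m := 3) hrd (fun b hb => (mem_blocksIn.1 hb).1)
    (empty_subset A) fun b hb => by simp [card_of_mem_rows (mem_blocksIn.1 hb).2]
  have hc3 := mul_card_add_card_le (m := 3) hcd (fun b hb => (mem_blocksIn.1 hb).1)
    (empty_subset A) fun b hb => by simp [card_of_mem_cols (mem_blocksIn.1 hb).2]
  rw [card_empty] at hr3 hc3
  rcases (blocksIn (rows s) A).eq_empty_or_nonempty with hr | ⟨r, hr⟩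
  · rw [hr, card_empty] at hle
    omega
  rcases (blocksIn (cols s) A).eq_empty_or_nonempty with hc | ⟨c, hc⟩
  · rw [hc, card_empty] at hle
    omega
  obtain ⟨hrA, hr⟩ := mem_blocksIn.1 hr
  obtain ⟨hcA, hc⟩ := mem_blocksIn.1 hc
  have hrc := mul_card_add_card_le (m := 2) hrd (fun b hb => (mem_blocksIn.1 hb).1) hcA
    fun b hb => by
      have hb := (mem_blocksIn.1 hb).2
      have h1 := card_inter_row_col_le hb hc
      have h2 := card_sdiff_add_card_inter b c
      rw [card_of_mem_rows hb] at h2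
      omega
  have hcr := mul_card_add_card_le (m := 2) hcd (fun b hb => (mem_blocksIn.1 hb).1) hrA
    fun b hb => by
      have hb := (mem_blocksIn.1 hb).2
      have h1 := card_inter_row_col_le hr hb
      have h2 := card_sdiff_add_card_inter b r
      rw [card_of_mem_cols hb, inter_comm] at h2
      omega
  rw [card_of_mem_cols hc] at hrc
  rw [card_of_mem_rows hr] at hcr
  omega

/-- The points of the `n`-th grid. -/
def grid (n : ℕ) : Finset ℕ := univ.biUnion (row n)

lemma card_grid (n : ℕ) : #(grid n) = 3 * (n + 3) := by
  rw [grid, card_biUnion]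
  · simp [card_row, ZMod.card, mul_comm]
  · intro a _ b _ hab
    refine disjoint_left.2 fun x hx hx' => hab ?_
    obtain ⟨d, rfl⟩ := exists_of_mem_row hx
    obtain ⟨d', h⟩ := exists_of_mem_row hx'
    exact (pt_inj.1 h).1

lemma row_subset_grid (n : ℕ) (a : ZMod (n + 3)) : row n a ⊆ grid n :=
  subset_biUnion_of_mem (row n) (mem_univ a)

lemma col_subset_grid (n : ℕ) (b : ZMod (n + 3)) : col n b ⊆ grid n := by
  intro x hx
  simp only [col, mem_insert, mem_singleton] at hx
  rcases hx with rfl | rfl | rfl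
  · exact row_subset_grid n b (by simp [row])
  · exact row_subset_grid n (b - 1) (by simp [row])
  · exact row_subset_grid n (b - 2) (by simp [row])

lemma exists_mem_col_of_mem_grid {n x : ℕ} (hx : x ∈ grid n) :
    ∃ a b, x ∈ row n a ∧ x ∈ col n b := by
  obtain ⟨a, -, hx⟩ := mem_biUnion.1 hx
  have hx' := hx
  simp only [row, mem_insert, mem_singleton] at hx'
  rcases hx' with rfl | rfl | rfl
  · exact ⟨a, a, hx, by simp [col]⟩
  · exact ⟨a, a + 1, hx, by simp [col]⟩
  · exact ⟨a, a + 2, hx, by simp [col]⟩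

lemma index_eq_of_grid_subset {n m : ℕ} (h : grid n ⊆ grid m) : n = m := by
  have h0 : pt n 0 0 ∈ grid m := h (row_subset_grid n 0 (by simp [row]))
  obtain ⟨a, -, ha⟩ := mem_biUnion.1 h0
  obtain ⟨b, hb⟩ := exists_of_mem_row ha
  exact index_eq_of_pt_eq hb

lemma confined_grid {n : ℕ} (hn : n ∈ s) : Confined (grids s) (grid n) := by
  intro x hx
  obtain ⟨a, b, ha, hb⟩ := exists_mem_col_of_mem_grid hx
  have hr : row n a ∈ rows s := ⟨n, hn, a, rfl⟩
  have hc : col n b ∈ cols s := ⟨n, hn, b, rfl⟩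
  refine ⟨_, Or.inl hr, _, Or.inr hc, fun h => ?_, ha, hb, row_subset_grid n a,
    col_subset_grid n b⟩
  have h1 := card_inter_row_col_le hr hc
  rw [← h, inter_self, card_row] at h1
  omega

lemma Confined.row_subset_and_col_subset {S : Finset ℕ} (hS : Confined (grids s) S) {n : ℕ}
    {a b : ZMod (n + 3)} (hx : pt n a b ∈ S) : row n a ⊆ S ∧ col n b ⊆ S := by
  have hrow : ∀ r ∈ rows s, pt n a b ∈ r → r = row n a := by
    rintro _ ⟨m, -, a', rfl⟩ h
    obtain ⟨d, hd⟩ := exists_of_mem_row h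
    obtain rfl := index_eq_of_pt_eq hd
    rw [(pt_inj.1 hd).1]
  have hcol : ∀ c ∈ cols s, pt n a b ∈ c → c = col n b := by
    rintro _ ⟨m, -, b', rfl⟩ h
    obtain ⟨d, hd⟩ := exists_of_mem_col h
    obtain rfl := index_eq_of_pt_eq hd
    rw [(pt_inj.1 hd).2]
  obtain ⟨r, hr | hr, c, hc | hc, hne, hxr, hxc, hrS, hcS⟩ := hS _ hx
  · exact (hne (rows_eq_of_mem hr hc hxr hxc)).elim
  · exact ⟨hrow r hr hxr ▸ hrS, hcol c hc hxc ▸ hcS⟩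
  · exact ⟨hrow c hc hxc ▸ hcS, hcol r hr hxr ▸ hrS⟩
  · exact (hne (cols_eq_of_mem hr hc hxr hxc)).elim

lemma Confined.exists_grid_subset {S : Finset ℕ} (hS : Confined (grids s) S)
    (hne : S.Nonempty) : ∃ n ∈ s, grid n ⊆ S := by
  obtain ⟨n, hn, a, ha⟩ : ∃ n ∈ s, ∃ a, pt n a a ∈ S := by
    obtain ⟨x, hx⟩ := hne
    obtain ⟨_, ⟨n, hn, a, rfl⟩ | ⟨n, hn, a, rfl⟩, -, -, -, -, -, hbS, -⟩ := hS x hx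
    · exact ⟨n, hn, a, hbS (by simp [row])⟩
    · exact ⟨n, hn, a, hbS (by simp [col])⟩
  have hall : ∀ k : ℕ, pt n (a + k) (a + k) ∈ S := by
    intro k
    induction k with
    | zero => simpa using ha
    | succ k ih =>
      have h1 : pt n (a + k) (a + k + 1) ∈ S :=
        (hS.row_subset_and_col_subset ih).1 (by simp [row])
      have h2 := (hS.row_subset_and_col_subset h1).2
      rw [Nat.cast_succ, ← add_assoc]
      exact h2 (by simp [col])
  refine ⟨n, hn, biUnion_subset.2 fun b _ => ?_⟩
  have hb : pt n b b ∈ S := by simpa using hall (b - a).val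
  exact (hS.row_subset_and_col_subset hb).1

end Grids

/-- The Steiner triple system attached to `s`. -/
def system (s : Set ℕ) : Set (Finset ℕ) := completion (grids s)

lemma exists_minimalConfined_iff {s : Set ℕ} {n : ℕ} :
    (∃ S, MinimalConfined (system s) S ∧ #S = 3 * (n + 3)) ↔ n ∈ s := by
  have hsub : ∀ {S}, Confined (system s) S → S.Nonempty → ∃ m ∈ s, grid m ⊆ S :=
    fun hS hne => (confined_of_confined_completion even_of_mem_grids hS).exists_grid_subset hne
  have hgrid : ∀ {m}, m ∈ s → Confined (system s) (grid m) := by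
    intro m hm x hx
    obtain ⟨b, hb, c, hc, h⟩ := confined_grid hm x hx
    exact ⟨b, Set.mem_iUnion.2 ⟨0, hb⟩, c, Set.mem_iUnion.2 ⟨0, hc⟩, h⟩
  have hne : ∀ m, (grid m).Nonempty := fun m => card_pos.1 (by rw [card_grid]; omega)
  constructor
  · rintro ⟨S, ⟨hSne, hS, hmin⟩, hcard⟩
    obtain ⟨m, hm, hmS⟩ := hsub hS hSne
    rw [← hmin _ hmS (hne m) (hgrid hm), card_grid] at hcard
    obtain rfl : m = n := by omega
    exact hm
  · refine fun hn => ⟨grid n, ⟨hne n, hgrid hn, fun T hT hTne hTc => ?_⟩, card_grid n⟩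
    obtain ⟨m, -, hmT⟩ := hsub hTc hTne
    obtain rfl := index_eq_of_grid_subset (hmT.trans hT)
    exact hT.antisymm hmT

lemma subset_of_equiv {s t : Set ℕ} (e : ℕ ≃ ℕ)
    (h : ∀ b, b ∈ system s ↔ b.map e.toEmbedding ∈ system t) : s ⊆ t := by
  intro n hn
  obtain ⟨S, hS, hcard⟩ := exists_minimalConfined_iff.2 hn
  exact exists_minimalConfined_iff.1 ⟨_, hS.map e h, by rw [card_map, hcard]⟩

lemma isSTS_image_coe {B : Set (Finset ℕ)} (hcard : ∀ b ∈ B, #b = 3) (hlin : IsLinear B)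
    (hex : ∀ x y, x ≠ y → ∃ b ∈ B, x ∈ b ∧ y ∈ b) :
    IsSTS ((fun b : Finset ℕ => (b : Set ℕ)) '' B) := by
  constructor
  · rintro _ ⟨b, hb, rfl⟩
    simpa [Set.ncard_coe_finset] using hcard b hb
  · intro x y hxy
    obtain ⟨b, hb, hx, hy⟩ := hex x y hxy
    refine ⟨b, ⟨⟨b, hb, rfl⟩, hx, hy⟩, ?_⟩
    rintro _ ⟨⟨c, hc, rfl⟩, hx', hy'⟩
    exact congrArg _ (hlin c hc b hb x y hxy hx' hy' hx hy)

lemma inftySparse_image_coe {B : Set (Finset ℕ)} (hB : IsSparse B) :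
    InftySparse ((fun b : Finset ℕ => (b : Set ℕ)) '' B) := by
  rintro ⟨A, hA, hδ⟩
  have himg : {ℓ ∈ (fun b : Finset ℕ => (b : Set ℕ)) '' B | ℓ ⊆ (A : Set ℕ)} =
      (fun b : Finset ℕ => (b : Set ℕ)) '' (blocksIn B A : Set (Finset ℕ)) := by
    ext ℓ
    constructor
    · rintro ⟨⟨b, hb, rfl⟩, hbA⟩
      exact ⟨b, mem_coe.2 (mem_blocksIn.2 ⟨coe_subset.1 hbA, hb⟩), rfl⟩
    · rintro ⟨b, hb, rfl⟩
      obtain ⟨hbA, hb⟩ := mem_blocksIn.1 (mem_coe.1 hb)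
      exact ⟨⟨b, hb, rfl⟩, coe_subset.2 hbA⟩
  rw [stsDelta, himg, Set.ncard_image_of_injective _ coe_injective, Set.ncard_coe_finset] at hδ
  have := hB A (by omega)
  omega

end SteinerTriple

/-- There exist continuum many pairwise non-isomorphic countable
`∞`-sparse Steiner triple systems: a function assigning to each `s ⊆ ℕ` a
family `B_s` of blocks on `ℕ` such that each `(ℕ, B_s)` is an `∞`-sparse
Steiner triple system and for `s ≠ t` no bijection of `ℕ` carries `B_s` onto
`B_t`. -/
theorem continuum_many_sparse_STS :
    ∃ F : Set ℕ → Set (Set ℕ),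
      (∀ s : Set ℕ, IsSTS (F s) ∧ InftySparse (F s)) ∧
      ∀ s t : Set ℕ, s ≠ t →
        ¬ ∃ e : ℕ ≃ ℕ, ∀ b : Set ℕ, b ∈ F s ↔ (e '' b) ∈ F t := by
  refine ⟨fun s => (fun b : Finset ℕ => (b : Set ℕ)) '' SteinerTriple.system s, fun s => ⟨?_, ?_⟩,
    ?_⟩
  · exact SteinerTriple.isSTS_image_coe
      (fun b => SteinerTriple.card_of_mem_completion fun _ => SteinerTriple.card_of_mem_grids)
      (SteinerTriple.isLinear_completion SteinerTriple.even_of_mem_grids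
        SteinerTriple.isLinear_grids)
      fun _ _ => SteinerTriple.exists_mem_completion
  · exact SteinerTriple.inftySparse_image_coe
      (SteinerTriple.isSparse_completion SteinerTriple.even_of_mem_grids
        (fun _ => SteinerTriple.card_of_mem_grids) SteinerTriple.isSparse_grids)
  · rintro s t hst ⟨e, he⟩
    have h : ∀ b : Finset ℕ,
        b ∈ SteinerTriple.system s ↔ b.map e.toEmbedding ∈ SteinerTriple.system t := by
      intro b
      have hb := he b
      have himg : e '' (b : Set ℕ) = ((b.map e.toEmbedding : Finset ℕ) : Set ℕ) := by simp
      rwa [himg, Finset.coe_injective.mem_set_image, Finset.coe_injective.mem_set_image] at hb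
    refine hst ((SteinerTriple.subset_of_equiv e h).antisymm
      (SteinerTriple.subset_of_equiv e.symm fun b => ?_))
    rw [h]
    have : (b.map e.symm.toEmbedding).map e.toEmbedding = b := by ext x; simp
    rw [this]
end

section
/- For every infinite cardinal κ there exists a Steiner triple system (M,B) with |M| = κ that is anti-Pasch: it contains no six distinct points a,b,c,d,e,f such that the blocks of B contained in {a,b,c,d,e,f} are exactly {a,b,c}, {a,d,e}, {b,d,f}, {c,e,f}. -/
universe u

/-- The triples of distinct points with sum zero in an additive commutative group. -/
def zeroSumTriples (M : Type*) [AddCommGroup M] : Set (Set M) :=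
  {s | s.ncard = 3 ∧ ∑ᶠ x ∈ s, x = 0}

section

variable {M : Type*} [AddCommGroup M]

theorem finsum_mem_triple {x y z : M} (hxy : x ≠ y) (hxz : x ≠ z) (hyz : y ≠ z) :
    ∑ᶠ t ∈ ({x, y, z} : Set M), t = x + y + z := by
  rw [finsum_mem_insert _ (by simp [hxy, hxz]) (Set.toFinite _), finsum_mem_pair hyz, add_assoc]

theorem triple_mem_zeroSumTriples {x y z : M} (hxy : x ≠ y) (hxz : x ≠ z) (hyz : y ≠ z) :
    ({x, y, z} : Set M) ∈ zeroSumTriples M ↔ x + y + z = 0 := by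
  simp only [zeroSumTriples, Set.mem_ofPred_eq, finsum_mem_triple hxy hxz hyz]
  exact and_iff_right (Set.ncard_eq_three.2 ⟨x, y, z, hxy, hxz, hyz, rfl⟩)

theorem eq_triple_of_mem_zeroSumTriples {s : Set M} (hs : s ∈ zeroSumTriples M) {x y : M}
    (hxy : x ≠ y) (hx : x ∈ s) (hy : y ∈ s) : s = {x, y, -(x + y)} := by
  obtain ⟨z, hxz, hyz, rfl⟩ : ∃ z, x ≠ z ∧ y ≠ z ∧ s = {x, y, z} := by
    obtain ⟨p, q, r, hpq, hpr, hqr, rfl⟩ := Set.ncard_eq_three.1 hs.1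
    simp only [Set.mem_insert_iff, Set.mem_singleton_iff] at hx hy
    rcases hx with rfl | rfl | rfl <;> rcases hy with rfl | rfl | rfl <;>
      first
      | exact absurd rfl hxy
      | exact ⟨p, by grind, by grind, by grind⟩
      | exact ⟨q, by grind, by grind, by grind⟩
      | exact ⟨r, by grind, by grind, by grind⟩
  rw [triple_mem_zeroSumTriples hxy hxz hyz] at hs
  rw [eq_neg_of_add_eq_zero_right hs]

/-- In a group of exponent three, the zero-sum triples form a Steiner triple system. -/
theorem isSTS_zeroSumTriples (h3 : ∀ x : M, x + x + x = 0) : IsSTS (zeroSumTriples M) := by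
  refine ⟨fun b hb => hb.1, fun x y hxy => ?_⟩
  have hx : x ≠ -(x + y) := fun h => hxy <| by
    rw [eq_neg_iff_add_eq_zero, ← add_assoc] at h
    exact add_left_cancel ((h3 x).trans h.symm)
  have hy : y ≠ -(x + y) := fun h => hxy <| by
    rw [eq_neg_iff_add_eq_zero, add_comm x y, ← add_assoc] at h
    exact (add_left_cancel ((h3 y).trans h.symm)).symm
  exact ⟨{x, y, -(x + y)}, ⟨(triple_mem_zeroSumTriples hxy hx hy).2 (add_neg_cancel _),
    by simp, by simp⟩, fun s hs => eq_triple_of_mem_zeroSumTriples hs.1 hxy hs.2.1 hs.2.2⟩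

/-- In a group of exponent three, the zero-sum triples contain no Pasch configuration. -/
theorem not_hasPasch_zeroSumTriples (h3 : ∀ x : M, x + x + x = 0) :
    ¬ HasPasch (zeroSumTriples M) := by
  rintro ⟨a, b, c, d, e, f, hd, h⟩
  simp only [List.pairwise_cons, List.mem_cons, List.not_mem_nil, or_false, forall_eq_or_imp,
    forall_eq, ne_eq] at hd
  obtain ⟨⟨hab, hac, had, hae, haf⟩, ⟨hbc, hbd, hbe, hbf⟩, ⟨hcd, hce, hcf⟩,
    ⟨hde, hdf⟩, hef, -⟩ := hd
  have mem : ∀ s ∈ ({ {a, b, c}, {a, d, e}, {b, d, f}, {c, e, f} } : Set (Set M)),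
      s ∈ zeroSumTriples M := fun s hs => (h.symm ▸ hs : s ∈ {ℓ ∈ zeroSumTriples M | _}).1
  have h₁ := (triple_mem_zeroSumTriples hab hac hbc).1 (mem _ (by simp))
  have h₂ := (triple_mem_zeroSumTriples had hae hde).1 (mem _ (by simp))
  have h₃ := (triple_mem_zeroSumTriples hbd hbf hdf).1 (mem _ (by simp))
  have h₄ := (triple_mem_zeroSumTriples hce hcf hef).1 (mem _ (by simp))
  apply haf
  have key : a - f = (a + a + a) - (f + f + f) -
      ((a + b + c) + (a + d + e) - (b + d + f) - (c + e + f)) := by abel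
  rw [h3, h3, h₁, h₂, h₃, h₄] at key
  exact sub_eq_zero.1 (by simpa using key)

end

/-- For every infinite cardinal `κ` there exists an anti-Pasch
Steiner triple system of cardinality `κ`. -/
theorem exists_antiPasch_STS (κ : Cardinal.{u}) (hκ : Cardinal.aleph0 ≤ κ) :
    ∃ (M : Type u) (B : Set (Set M)),
      Cardinal.mk M = κ ∧ IsSTS B ∧ ¬ HasPasch B := by
  obtain ⟨α, rfl⟩ : ∃ α : Type u, Cardinal.mk α = κ := ⟨κ.out, κ.mk_out⟩
  have : Infinite α := Cardinal.infinite_iff.2 hκ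
  have h3 (x : α →₀ ZMod 3) : x + x + x = 0 := by
    ext i
    simp only [Finsupp.add_apply, Finsupp.zero_apply]
    generalize x i = t
    revert t
    decide
  refine ⟨α →₀ ZMod 3, zeroSumTriples _, ?_, isSTS_zeroSumTriples h3,
    not_hasPasch_zeroSumTriples h3⟩
  rw [Cardinal.mk_finsupp_lift_of_infinite]
  have h : (3 : Cardinal.{u}) ≤ Cardinal.mk α := by
    exact_mod_cast (Cardinal.natCast_le_aleph0 (n := 3)).trans hκ
  simpa using h
end

section
/- For every infinite cardinal κ there exists a Steiner triple system of cardinality κ containing no mitre configuration, and there exists a Steiner triple system of cardinality κ containing no mia configuration. -/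
universe u

/-- The lines of the projective space over `𝔽₂` whose points are the nonzero elements of an
elementary abelian 2-group `G`: the triples of distinct points with sum zero. -/
def binaryLines (G : Type*) [AddCommGroup G] : Set (Set {g : G // g ≠ 0}) :=
  {b | b.ncard = 3 ∧ ∀ x ∈ b, ∀ y ∈ b, ∀ z ∈ b, x ≠ y → x ≠ z → y ≠ z →
    (x : G) + y + z = 0}

section BinaryLines

variable {G : Type*} [AddCommGroup G]

theorem sum_eq_zero_of_mem_binaryLines {x y z : {g : G // g ≠ 0}}
    (h : {x, y, z} ∈ binaryLines G) (hxy : x ≠ y) (hxz : x ≠ z) (hyz : y ≠ z) :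
    (x : G) + y + z = 0 :=
  h.2 x (by simp) y (by simp) z (by simp) hxy hxz hyz

theorem mem_binaryLines_of_sum_eq_zero {x y z : {g : G // g ≠ 0}}
    (hxy : x ≠ y) (hxz : x ≠ z) (hyz : y ≠ z) (h : (x : G) + y + z = 0) :
    {x, y, z} ∈ binaryLines G := by
  refine ⟨Set.ncard_eq_three.2 ⟨x, y, z, hxy, hxz, hyz, rfl⟩, ?_⟩
  simp only [Set.mem_insert_iff, Set.mem_singleton_iff]
  rintro _ (rfl | rfl | rfl) _ (rfl | rfl | rfl) _ (rfl | rfl | rfl) h₁ h₂ h₃ <;>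
    first
    | exact absurd rfl ‹_›
    | (refine Eq.trans ?_ h; abel)

theorem isSTS_binaryLines (hG : ∀ g : G, g + g = 0) : IsSTS (binaryLines G) := by
  refine ⟨fun b hb => hb.1, fun x y hxy => ?_⟩
  have hxy' : (x : G) ≠ y := fun h => hxy (Subtype.ext h)
  have hz : (x : G) + y ≠ 0 := fun h => hxy' (by
    have := hG y
    grind)
  obtain ⟨z, hzv⟩ : ∃ z : {g : G // g ≠ 0}, (z : G) = x + y := ⟨⟨_, hz⟩, rfl⟩
  have hxz : x ≠ z := by
    rintro rfl
    exact y.2 (by simpa using hzv)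
  have hyz : y ≠ z := by
    rintro rfl
    exact x.2 (by simpa using hzv)
  refine ⟨{x, y, z}, ⟨mem_binaryLines_of_sum_eq_zero hxy hxz hyz ?_, by simp, by simp⟩, ?_⟩
  · rw [hzv]
    exact hG _
  · rintro b ⟨hb, hxb, hyb⟩
    have key : ∀ w ∈ b, x ≠ w → y ≠ w → w = z := by
      intro w hw hxw hyw
      have := hb.2 x hxb y hyb w hw hxy hxw hyw
      apply Subtype.ext
      have := hG w
      grind
    have hsub : b ⊆ {x, y, z} := by
      intro w hw
      simp only [Set.mem_insert_iff, Set.mem_singleton_iff]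
      grind
    refine Set.eq_of_subset_of_ncard_le hsub ?_ (Set.toFinite _)
    rw [hb.1, Set.ncard_eq_three.2 ⟨x, y, z, hxy, hxz, hyz, rfl⟩]

theorem not_hasMitre_binaryLines (hG : ∀ g : G, g + g = 0) : ¬ HasMitre (binaryLines G) := by
  rintro ⟨x, a, b, c, a', b', c', hd, he⟩
  have hB : ∀ ℓ ∈ ({ {a, b, c}, {a', b', c'}, {x, a, c'}, {x, b, b'}, {x, c, a'} } :
      Set (Set {g : G // g ≠ 0})), ℓ ∈ binaryLines G := fun ℓ hℓ => (he ▸ hℓ).1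
  simp only [List.pairwise_cons, List.mem_cons, List.not_mem_nil, or_false, forall_eq_or_imp,
    forall_eq] at hd
  have h₁ := sum_eq_zero_of_mem_binaryLines (hB {a, b, c} (by simp)) (by tauto) (by tauto)
    (by tauto)
  have h₂ := sum_eq_zero_of_mem_binaryLines (hB {a', b', c'} (by simp)) (by tauto) (by tauto)
    (by tauto)
  have h₃ := sum_eq_zero_of_mem_binaryLines (hB {x, a, c'} (by simp)) (by tauto) (by tauto)
    (by tauto)
  have h₄ := sum_eq_zero_of_mem_binaryLines (hB {x, b, b'} (by simp)) (by tauto) (by tauto)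
    (by tauto)
  have h₅ := sum_eq_zero_of_mem_binaryLines (hB {x, c, a'} (by simp)) (by tauto) (by tauto)
    (by tauto)
  refine x.2 ?_
  have := hG x
  grind

/-- Any four lines in Pasch position span a Fano plane, which has seven lines rather than five. -/
theorem not_hasMia_binaryLines (hG : ∀ g : G, g + g = 0) : ¬ HasMia (binaryLines G) := by
  rintro ⟨a, b, c, d, e, f, g, hd, he⟩
  have hB : ∀ ℓ ∈ ({ {a, b, c}, {a, d, e}, {b, d, f}, {c, e, f}, {c, d, g} } :
      Set (Set {g : G // g ≠ 0})), ℓ ∈ binaryLines G := fun ℓ hℓ => (he ▸ hℓ).1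
  simp only [List.pairwise_cons, List.mem_cons, List.not_mem_nil, or_false, forall_eq_or_imp,
    forall_eq] at hd
  have h₁ := sum_eq_zero_of_mem_binaryLines (hB {a, b, c} (by simp)) (by tauto) (by tauto)
    (by tauto)
  have h₂ := sum_eq_zero_of_mem_binaryLines (hB {b, d, f} (by simp)) (by tauto) (by tauto)
    (by tauto)
  have h₃ := sum_eq_zero_of_mem_binaryLines (hB {c, d, g} (by simp)) (by tauto) (by tauto)
    (by tauto)
  have hafg : {a, f, g} ∈ binaryLines G := by
    refine mem_binaryLines_of_sum_eq_zero (by tauto) (by tauto) (by tauto) ?_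
    have hb := hG b
    have hc := hG c
    have hd := hG d
    grind
  have hmem : {a, f, g} ∈ {ℓ ∈ binaryLines G | ℓ ⊆ {a, b, c, d, e, f, g}} :=
    ⟨hafg, by grind⟩
  rw [he] at hmem
  simp only [Set.mem_insert_iff, Set.mem_singleton_iff] at hmem
  have ha : a ∈ ({a, f, g} : Set {g : G // g ≠ 0}) := by simp
  have hf : f ∈ ({a, f, g} : Set {g : G // g ≠ 0}) := by simp
  rcases hmem with h | h | h | h | h <;> rw [h] at ha hf <;>
    simp only [Set.mem_insert_iff, Set.mem_singleton_iff] at ha hf <;> grind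

end BinaryLines

theorem Cardinal.mk_ne_zero_subtype_of_infinite (G : Type*) [Zero G] [Infinite G] :
    Cardinal.mk {g : G // g ≠ 0} = Cardinal.mk G :=
  Cardinal.mk_compl_of_infinite ({0} : Set G) <| by
    simpa using Cardinal.one_lt_aleph0.trans_le (Cardinal.aleph0_le_mk G)

/-- For every infinite cardinal `κ` there exists a Steiner
triple system of cardinality `κ` containing no mitre configuration, and there
exists a Steiner triple system of cardinality `κ` containing no mia
configuration. -/
theorem exists_antiMitre_antiMia_STS (κ : Cardinal.{u})
    (hκ : Cardinal.aleph0 ≤ κ) :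
    (∃ (M : Type u) (B : Set (Set M)),
      Cardinal.mk M = κ ∧ IsSTS B ∧ ¬ HasMitre B) ∧
    (∃ (M : Type u) (B : Set (Set M)),
      Cardinal.mk M = κ ∧ IsSTS B ∧ ¬ HasMia B) := by
  induction κ using Cardinal.inductionOn with | mk ι
  have : Infinite ι := Cardinal.infinite_iff.2 hκ
  have hG : ∀ v : ι →₀ ZMod 2, v + v = 0 := fun v => by
    ext i
    exact CharTwo.add_self_eq_zero _
  have hcard : Cardinal.mk {v : ι →₀ ZMod 2 // v ≠ 0} = Cardinal.mk ι := by
    rw [Cardinal.mk_ne_zero_subtype_of_infinite, Cardinal.mk_finsupp_lift_of_infinite]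
    simpa using (Cardinal.natCast_lt_aleph0 (n := 2)).le.trans hκ
  exact ⟨⟨_, _, hcard, isSTS_binaryLines hG, not_hasMitre_binaryLines hG⟩,
    ⟨_, _, hcard, isSTS_binaryLines hG, not_hasMia_binaryLines hG⟩⟩
end

section
/- Let F be a finite field with |F| > 2 and let a be a generator of the multiplicative group F^×. Define x * y = y + (x − y)·a. Then every subset S ⊆ F that is closed under * and contains at least two distinct elements equals F; that is, the subquasigroup of (F, *) generated by any two distinct elements is all of F. -/
/-- The block-algebra multiplication on a field: `x * y = y + (x − y)·a`. -/
def blockOp {F : Type*} [Field F] (a : F) (x y : F) : F :=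
  y + (x - y) * a

/-- Let `F` be a finite field with more than 2 elements and `a`
a generator of the multiplicative group `Fˣ`.  For the block-algebra
operation `x * y = y + (x − y)·a`, every subset of `F` closed under the
operation and containing two distinct elements is all of `F`: the
subquasigroup generated by any two distinct elements is all of `F`. -/
theorem blockOp_two_generated (F : Type*) [Field F] [Fintype F]
    (hcard : 2 < Fintype.card F) (a : Fˣ)
    (hgen : ∀ u : Fˣ, u ∈ Subgroup.zpowers a) :
    ∀ S : Set F, (∀ x ∈ S, ∀ y ∈ S, blockOp (a : F) x y ∈ S) →
      (∃ x ∈ S, ∃ y ∈ S, x ≠ y) → S = Set.univ := by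
  rintro S hS ⟨x, hx, y, hy, hxy⟩
  have hpow : ∀ n : ℕ, y + (x - y) * (a : F) ^ n ∈ S := by
    intro n
    induction n with
    | zero => simpa using hx
    | succ n ih =>
      have h := hS _ ih y hy
      rwa [blockOp, add_sub_cancel_left, mul_assoc, ← pow_succ] at h
  refine Set.eq_univ_of_forall fun z => ?_
  by_cases hzy : z = y
  · rwa [hzy]
  have hxy' : x - y ≠ 0 := sub_ne_zero.mpr hxy
  have hz : (z - y) / (x - y) ≠ 0 := div_ne_zero (sub_ne_zero.mpr hzy) hxy'
  obtain ⟨n, hn⟩ := mem_powers_iff_mem_zpowers.mpr (hgen (Units.mk0 _ hz))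
  have hn' : (a : F) ^ n = (z - y) / (x - y) := by
    simpa using congrArg Units.val hn
  have h := hpow n
  rwa [hn', mul_div_cancel₀ _ hxy', add_sub_cancel] at h
end

section
/- Let (C,L) be a finite nonempty linear space with δ(C) ≤ 0. Then C contains two distinct lines that share a common point; in particular, C contains three points that do not all lie on a common line. -/
open scoped Classical

variable {M : Type*}

/-- A nonempty finite linear space whose lines are pairwise disjoint has positive predimension. -/
theorem delta_univ_pos_of_pairwiseDisjoint [Fintype M] [Nonempty M] (LS : LinearSpace M)
    (hd : LS.lines.PairwiseDisjoint id) : 0 < delta LS Finset.univ := by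
  unfold delta
  set T := (lineContrib_finite LS Finset.univ).toFinset
  have hsub : ∀ ℓ ∈ T, ℓ ∈ LS.lines := fun ℓ hℓ =>
    ((lineContrib_finite LS Finset.univ).mem_toFinset.mp hℓ).1
  have hcard : ∑ ℓ ∈ T, (Finset.univ.filter (· ∈ ℓ)).card ≤ Fintype.card M := by
    rw [← Finset.card_biUnion]
    · exact Finset.card_le_univ _
    · intro ℓ₁ h₁ ℓ₂ h₂ hne
      rw [Function.onFun, Finset.disjoint_left]
      intro x hx₁ hx₂
      exact Set.disjoint_left.mp (hd (hsub _ h₁) (hsub _ h₂) hne)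
        (Finset.mem_filter.mp hx₁).2 (Finset.mem_filter.mp hx₂).2
  rw [Finset.sum_sub_distrib, Finset.sum_const, Finset.card_univ, nsmul_eq_mul]
  have hcard' : ∑ ℓ ∈ T, ((Finset.univ.filter (· ∈ ℓ)).card : ℤ) ≤ Fintype.card M := by
    exact_mod_cast hcard
  rcases T.eq_empty_or_nonempty with hE | hne
  · simp [hE, Fintype.card_pos]
  · have := hne.card_pos
    omega

/-- Every line contains a point different from a given one. -/
theorem LinearSpace.exists_mem_ne (LS : LinearSpace M) {ℓ : Set M} (hℓ : ℓ ∈ LS.lines) (x : M) :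
    ∃ y ∈ ℓ, y ≠ x := by
  obtain ⟨a, b, -, ha, hb, -, hab, -, -⟩ := LS.three_le ℓ hℓ
  by_cases hax : a = x
  · exact ⟨b, hb, fun hbx => hab (hax.trans hbx.symm)⟩
  · exact ⟨a, ha, hax⟩

/-- Two distinct lines through a common point carry three points that are not collinear. -/
theorem LinearSpace.exists_not_collin (LS : LinearSpace M) {ℓ₁ ℓ₂ : Set M}
    (h₁ : ℓ₁ ∈ LS.lines) (h₂ : ℓ₂ ∈ LS.lines) (hne : ℓ₁ ≠ ℓ₂) (hx : (ℓ₁ ∩ ℓ₂).Nonempty) :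
    ∃ x y z : M, x ≠ y ∧ x ≠ z ∧ y ≠ z ∧ ¬ Collin LS x y z := by
  obtain ⟨x, hx₁, hx₂⟩ := hx
  obtain ⟨y, hy, hyx⟩ := LS.exists_mem_ne h₁ x
  obtain ⟨z, hz, hzx⟩ := LS.exists_mem_ne h₂ x
  refine ⟨x, y, z, hyx.symm, hzx.symm, ?_, ?_⟩
  · rintro rfl
    exact hne (LS.unique_line hyx h₁ h₂ hy hx₁ hz hx₂)
  · rintro ⟨ℓ, hℓ, hxℓ, hyℓ, hzℓ⟩
    exact hne ((LS.unique_line hyx h₁ hℓ hy hx₁ hyℓ hxℓ).trans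
      (LS.unique_line hzx hℓ h₂ hzℓ hxℓ hz hx₂))

/-- A finite nonempty linear space `C` with `δ(C) ≤ 0` contains
two distinct lines sharing a common point; in particular it contains three
distinct points that do not all lie on a common line. -/
theorem exists_intersecting_lines_of_delta_nonpos
    (M : Type*) [Fintype M] [Nonempty M] (LS : LinearSpace M)
    (h : delta LS Finset.univ ≤ 0) :
    (∃ ℓ₁ ∈ LS.lines, ∃ ℓ₂ ∈ LS.lines, ℓ₁ ≠ ℓ₂ ∧ (ℓ₁ ∩ ℓ₂).Nonempty) ∧
    (∃ x y z : M, x ≠ y ∧ x ≠ z ∧ y ≠ z ∧ ¬ Collin LS x y z) := by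
  have hmeet : ∃ ℓ₁ ∈ LS.lines, ∃ ℓ₂ ∈ LS.lines, ℓ₁ ≠ ℓ₂ ∧ (ℓ₁ ∩ ℓ₂).Nonempty := by
    by_contra hno
    refine h.not_gt (delta_univ_pos_of_pairwiseDisjoint LS fun ℓ₁ h₁ ℓ₂ h₂ hne => ?_)
    by_contra hdis
    exact hno ⟨ℓ₁, h₁, ℓ₂, h₂, hne, Set.not_disjoint_iff_nonempty_inter.mp hdis⟩
  obtain ⟨ℓ₁, h₁, ℓ₂, h₂, hne, hx⟩ := hmeet
  exact ⟨⟨ℓ₁, h₁, ℓ₂, h₂, hne, hx⟩, LS.exists_not_collin h₁ h₂ hne hx⟩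
end

section
/- Let A be a finite set with a ternary relation R that holds only on triples of pairwise distinct elements and is invariant under permutations of its arguments, and define δ_H(S) = |S| − (number of 3-element subsets {x,y,z} of S with R(x,y,z)). Assume every subset S ⊆ A with |S| ≤ 3 is strong in A, i.e. δ_H(T) ≥ δ_H(S) for every T with S ⊆ T ⊆ A. Then for all distinct a, b ∈ A there is at most one c ∈ A with R(a,b,c); consequently every R-clique of A has at most 3 elements, so A, with R interpreted as collinearity, is a partial Steiner triple system. -/
open scoped Classical

/-- The Hrushovski predimension of a finite set `S`:
`δ_H(S) = |S| − (number of 3-element subsets of S satisfying R)`. -/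
noncomputable def deltaH {M : Type*} (R : M → M → M → Prop) (S : Finset M) : ℤ :=
  (S.card : ℤ) -
    ((S.powersetCard 3).filter (fun t => ∃ x y z : M, R x y z ∧ t = {x, y, z})).card

/-- Any family of `R`-triples inside `T` bounds the predimension of `T` from above. -/
theorem deltaH_le_of_triples {M : Type*} {R : M → M → M → Prop} {T : Finset M}
    (F : Finset (Finset M))
    (hF : ∀ t ∈ F, t ⊆ T ∧ t.card = 3 ∧ ∃ x y z : M, R x y z ∧ t = {x, y, z}) :
    deltaH R T ≤ (T.card : ℤ) - F.card := by
  have h : F ⊆ (T.powersetCard 3).filter (fun t => ∃ x y z : M, R x y z ∧ t = {x, y, z}) := by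
    intro t ht
    obtain ⟨h1, h2, h3⟩ := hF t ht
    exact Finset.mem_filter.2 ⟨Finset.mem_powersetCard.2 ⟨h1, h2⟩, h3⟩
  have hc := Finset.card_le_card h
  unfold deltaH
  omega

/-- A set containing no `R`-triple has predimension equal to its cardinality. -/
theorem deltaH_eq_card {M : Type*} {R : M → M → M → Prop} {S : Finset M}
    (hS : ∀ x ∈ S, ∀ y ∈ S, ∀ z ∈ S, ¬ R x y z) : deltaH R S = S.card := by
  have h : (S.powersetCard 3).filter (fun t => ∃ x y z : M, R x y z ∧ t = {x, y, z}) = ∅ := by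
    refine Finset.filter_eq_empty_iff.2 ?_
    rintro t ht ⟨x, y, z, hR, rfl⟩
    have hs := (Finset.mem_powersetCard.1 ht).1
    exact hS x (hs (by simp)) y (hs (by simp)) z (hs (by simp)) hR
  unfold deltaH
  rw [h]
  simp

/-- If all sets of size at most 3 are strong, two distinct points lie on at most one
`R`-triple. -/
theorem eq_of_strong {M : Type*} {R : M → M → M → Prop}
    (hdist : ∀ x y z : M, R x y z → x ≠ y ∧ x ≠ z ∧ y ≠ z)
    (hsym : ∀ x y z : M, (R x y z ↔ R y x z) ∧ (R x y z ↔ R x z y))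
    (hstrong : ∀ S T : Finset M, S.card ≤ 3 → S ⊆ T → deltaH R S ≤ deltaH R T)
    {a b c d : M} (hc : R a b c) (hd : R a b d) : c = d := by
  by_contra hcd
  obtain ⟨hab, hac, hbc⟩ := hdist _ _ _ hc
  obtain ⟨-, had, hbd⟩ := hdist _ _ _ hd
  have hT : ({a, b, c, d} : Finset M).card = 4 := by
    simp [Finset.card_insert_of_notMem, hab, hac, hbc, had, hbd, hcd]
  have hne : ({a, b, c} : Finset M) ≠ {a, b, d} := fun h => by
    have : c ∈ ({a, b, d} : Finset M) := h ▸ (by simp)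
    simp [hac.symm, hbc.symm, hcd] at this
  have triple : ∀ x y z : M, R x y z → ({x, y, z} : Finset M).card = 3 ∧
      ∃ x' y' z' : M, R x' y' z' ∧ ({x, y, z} : Finset M) = {x', y', z'} := fun x y z h =>
    ⟨Finset.card_eq_three.2
      ⟨x, y, z, (hdist _ _ _ h).1, (hdist _ _ _ h).2.1, (hdist _ _ _ h).2.2, rfl⟩,
      x, y, z, h, rfl⟩
  by_cases hacd : R a c d
  · have hb1 : ({a, b, c} : Finset M) ≠ {a, c, d} := fun h => by
      have : b ∈ ({a, c, d} : Finset M) := h ▸ (by simp)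
      simp [hab.symm, hbc, hbd] at this
    have hb2 : ({a, b, d} : Finset M) ≠ {a, c, d} := fun h => by
      have : b ∈ ({a, c, d} : Finset M) := h ▸ (by simp)
      simp [hab.symm, hbc, hbd] at this
    have hF : ({{a, b, c}, {a, b, d}, {a, c, d}} : Finset (Finset M)).card = 3 :=
      Finset.card_eq_three.2 ⟨_, _, _, hne, hb1, hb2, rfl⟩
    have h1 := deltaH_le_of_triples (R := R) (T := {a, b, c, d})
      {{a, b, c}, {a, b, d}, {a, c, d}} (by
        intro t ht
        simp only [Finset.mem_insert, Finset.mem_singleton] at ht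
        rcases ht with rfl | rfl | rfl
        · exact ⟨by grind, triple _ _ _ hc⟩
        · exact ⟨by grind, triple _ _ _ hd⟩
        · exact ⟨by grind, triple _ _ _ hacd⟩)
    have h2 : deltaH R {a, b} = (({a, b} : Finset M).card : ℤ) := deltaH_eq_card (by
      intro x hx y hy z hz h
      have := hdist _ _ _ h
      grind)
    have hS : ({a, b} : Finset M).card = 2 := Finset.card_pair hab
    have h3 := hstrong {a, b} {a, b, c, d} (by omega) (by grind)
    omega
  · have hF : ({{a, b, c}, {a, b, d}} : Finset (Finset M)).card = 2 := Finset.card_pair hne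
    have h1 := deltaH_le_of_triples (R := R) (T := {a, b, c, d})
      {{a, b, c}, {a, b, d}} (by
        intro t ht
        simp only [Finset.mem_insert, Finset.mem_singleton] at ht
        rcases ht with rfl | rfl
        · exact ⟨by grind, triple _ _ _ hc⟩
        · exact ⟨by grind, triple _ _ _ hd⟩)
    have h2 : deltaH R {a, c, d} = (({a, c, d} : Finset M).card : ℤ) := deltaH_eq_card (by
      intro x hx y hy z hz h
      have := hdist _ _ _ h
      simp only [Finset.mem_insert, Finset.mem_singleton] at hx hy hz
      grind)
    have hS : ({a, c, d} : Finset M).card = 3 :=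
      Finset.card_eq_three.2 ⟨_, _, _, hac, had, hcd, rfl⟩
    have h3 := hstrong {a, c, d} {a, b, c, d} (by omega) (by grind)
    omega

/-- Let `A` be a finite set with a ternary relation `R` holding
only on pairwise distinct triples and invariant under permutations of its
arguments.  If every subset of size at most 3 is strong in `A` with respect to
the Hrushovski predimension `δ_H`, then any two distinct points lie on at most
one `R`-triple, and every `R`-clique has at most 3 elements (so `A`, with `R`
as collinearity, is a partial Steiner triple system). -/
theorem hrushovski_partial_STS (M : Type*) [Fintype M] (R : M → M → M → Prop)
    (hdist : ∀ x y z : M, R x y z → x ≠ y ∧ x ≠ z ∧ y ≠ z)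
    (hsym : ∀ x y z : M, (R x y z ↔ R y x z) ∧ (R x y z ↔ R x z y))
    (hstrong : ∀ S T : Finset M, S.card ≤ 3 → S ⊆ T → deltaH R S ≤ deltaH R T) :
    (∀ a b : M, a ≠ b → ∀ c c' : M, R a b c → R a b c' → c = c') ∧
    (∀ S : Finset M,
      (∀ x ∈ S, ∀ y ∈ S, ∀ z ∈ S, x ≠ y → x ≠ z → y ≠ z → R x y z) →
      S.card ≤ 3) := by
  refine ⟨fun a b _ c c' hc hc' => eq_of_strong hdist hsym hstrong hc hc', ?_⟩
  intro S hS
  by_contra! hcard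
  obtain ⟨U, hUS, hU⟩ := Finset.exists_subset_card_eq (show 4 ≤ S.card from hcard)
  obtain ⟨a, b, c, d, hab, hac, had, hbc, hbd, hcd, rfl⟩ := Finset.card_eq_four.1 hU
  have ha : a ∈ S := hUS (by simp)
  have hb : b ∈ S := hUS (by simp)
  have hc : c ∈ S := hUS (by simp)
  have hd : d ∈ S := hUS (by simp)
  exact hcd (eq_of_strong hdist hsym hstrong (hS a ha b hb c hc hab hac hbc)
    (hS a ha b hb d hd hab had hbd))
end
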